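/- arXiv:2501.00335 — 5 statements merged into one kernel-verified Lean document; each statement's English description precedes it below -/
import Mathlib

section
/- For every positive integer n, there exists a bijection between the set 𝒮_n of snakes of length n and the set 𝒫_n of labeled ballot paths of length n; in particular |𝒮_n| = |𝒫_n|. -/
/-- A signed permutation of length `n`: a sequence of nonzero integers whose
absolute values form a permutation of `{1, …, n}`. -/
def IsSignedPerm (n : ℕ) (π : Fin n → ℤ) : Prop :=
  Function.Injective (fun i => (π i).natAbs) ∧
  ∀ i, 1 ≤ (π i).natAbs ∧ (π i).natAbs ≤ n

/-- The down-up (alternating) property `a₁ > a₂ < a₃ > a₄ < ⋯` (positions `0`-indexed). -/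
def DownUpZ (n : ℕ) (a : Fin n → ℤ) : Prop :=
  ∀ i : ℕ, ∀ h : i + 1 < n,
    if i % 2 = 0 then a ⟨i + 1, h⟩ < a ⟨i, by omega⟩
    else a ⟨i, by omega⟩ < a ⟨i + 1, h⟩

/-- A snake of length `n`: a signed permutation with `π₁ > 0` satisfying the down-up property. -/
def IsSnake (n : ℕ) (π : Fin n → ℤ) : Prop :=
  IsSignedPerm n π ∧ (∀ h : 0 < n, 0 < π ⟨0, h⟩) ∧ DownUpZ n π

/-- Number of up steps among the first `i` steps of `p` (`true` = up `U`). -/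
def upCount (n : ℕ) (p : Fin n → Bool) (i : ℕ) : ℕ :=
  (Finset.univ.filter (fun j : Fin n => (j : ℕ) < i ∧ p j = true)).card

/-- Number of down steps among the first `i` steps of `p` (`false` = down `D`). -/
def downCount (n : ℕ) (p : Fin n → Bool) (i : ℕ) : ℕ :=
  (Finset.univ.filter (fun j : Fin n => (j : ℕ) < i ∧ p j = false)).card

/-- A ballot path: every prefix has at least as many up steps as down steps. -/
def IsBallot (n : ℕ) (p : Fin n → Bool) : Prop :=
  ∀ i ≤ n, downCount n p i ≤ upCount n p i

/-- A labeled ballot path `(P, w)`: a ballot path together with labels satisfying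
`0 ≤ wᵢ ≤ hᵢ(P)` for up steps and `0 ≤ wᵢ ≤ hᵢ(P) - 1` for down steps, where
`hᵢ(P) = upCount - downCount` is the height of the `i`-th step. -/
def IsLBP (n : ℕ) (pw : (Fin n → Bool) × (Fin n → ℕ)) : Prop :=
  IsBallot n pw.1 ∧
  ∀ i : Fin n,
    if pw.1 i then pw.2 i + downCount n pw.1 i ≤ upCount n pw.1 i
    else pw.2 i + 1 + downCount n pw.1 i ≤ upCount n pw.1 i

open Polynomial

/-! ### The derivative polynomials of the secant -/

/-- The operator `P ↦ (1 + X²) P' + X P`, which is differentiation of `sec x * P (tan x)` expressed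
in the variable `X = tan x`. -/
noncomputable def secDeriv : Module.End ℤ ℤ[X] :=
  LinearMap.mulLeft ℤ (1 + X ^ 2) ∘ₗ derivative + LinearMap.mulLeft ℤ X

theorem secDeriv_apply (P : ℤ[X]) : secDeriv P = (1 + X ^ 2) * derivative P + X * P := rfl

theorem secDeriv_X_pow (h : ℕ) :
    secDeriv (X ^ h) = (h + 1) • X ^ (h + 1) + h • X ^ (h - 1) := by
  rw [secDeriv_apply, derivative_X_pow]
  cases h with
  | zero => simp
  | succ k =>
    simp only [nsmul_eq_mul, Nat.add_sub_cancel]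
    push_cast
    simp only [map_add, map_one, map_natCast]
    ring

/-- The real and imaginary parts of `(1 + i) (secDeriv + i) ^ r 1`. -/
noncomputable def secPair : ℕ → ℤ[X] × ℤ[X]
  | 0 => (1, 1)
  | r + 1 => (secDeriv (secPair r).1 - (secPair r).2, secDeriv (secPair r).2 + (secPair r).1)

theorem exists_secPair_succ_eq (r : ℕ) :
    ∃ R : ℤ[X], secPair (r + 1) = ((X - 1) * R, (X + 1) * R) := by
  induction r with
  | zero => exact ⟨1, by simp [secPair, secDeriv_apply]⟩
  | succ r ih =>
    obtain ⟨R, hR⟩ := ih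
    refine ⟨(1 + X ^ 2) * derivative R + 2 * X * R, ?_⟩
    rw [secPair, hR, Prod.mk.injEq]
    constructor <;> simp [secDeriv_apply] <;> ring

/-- The number of alternating signed words `x < a₁ > a₂ < ⋯` on an alphabet of `n` absolute
values, `r` of which are less than `|x|`, for `0 ≤ x`. -/
noncomputable def snakeNonneg (n r : ℕ) : ℤ := ((secDeriv ^ (n - r)) (secPair r).1).eval 1

/-- The number of alternating signed words `x < a₁ > a₂ < ⋯` on an alphabet of `n` absolute
values, `r` of which are less than `|x|`, for `x < 0`. -/
noncomputable def snakeNeg (n r : ℕ) : ℤ := ((secDeriv ^ (n - r)) (secPair r).2).eval 1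

theorem snakeNonneg_succ_succ {n r : ℕ} (h : r ≤ n) :
    snakeNonneg (n + 1) (r + 1) = snakeNonneg (n + 1) r - snakeNeg n r := by
  simp only [snakeNonneg, snakeNeg, secPair, Nat.add_sub_add_right, Nat.sub_add_comm h,
    pow_succ, Module.End.mul_apply, map_sub, eval_sub]

theorem snakeNeg_succ_succ {n r : ℕ} (h : r ≤ n) :
    snakeNeg (n + 1) (r + 1) = snakeNeg (n + 1) r + snakeNonneg n r := by
  simp only [snakeNonneg, snakeNeg, secPair, Nat.add_sub_add_right, Nat.sub_add_comm h,
    pow_succ, Module.End.mul_apply, map_add, eval_add]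

theorem snakeNonneg_succ_self (n : ℕ) : snakeNonneg (n + 1) (n + 1) = 0 := by
  obtain ⟨R, hR⟩ := exists_secPair_succ_eq n
  simp [snakeNonneg, hR]

theorem snakeNeg_zero_right (n : ℕ) : snakeNeg n 0 = snakeNonneg n 0 := rfl

theorem snakeNonneg_succ_eq_zero_sub {n r : ℕ} (h : r ≤ n + 1) :
    snakeNonneg (n + 1) r = snakeNonneg (n + 1) 0 - ∑ j ∈ Finset.range r, snakeNeg n j := by
  induction r with
  | zero => simp
  | succ r ih =>
    rw [snakeNonneg_succ_succ (by omega), ih (by omega), Finset.sum_range_succ]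
    ring

theorem snakeNonneg_succ_zero (n : ℕ) :
    snakeNonneg (n + 1) 0 = ∑ j ∈ Finset.range (n + 1), snakeNeg n j := by
  have := snakeNonneg_succ_eq_zero_sub (le_refl (n + 1))
  rw [snakeNonneg_succ_self] at this
  linarith

theorem snakeNeg_succ_eq {n r : ℕ} (h : r ≤ n + 1) :
    snakeNeg (n + 1) r = snakeNonneg (n + 1) 0 + ∑ j ∈ Finset.range r, snakeNonneg n j := by
  induction r with
  | zero => simp [snakeNeg_zero_right]
  | succ r ih =>
    rw [snakeNeg_succ_succ (by omega), ih (by omega), Finset.sum_range_succ]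
    ring

/-! ### Counting labeled ballot paths -/

/-- A labeled ballot path starting at height `h`. -/
def IsLBPFrom (h n : ℕ) (pw : (Fin n → Bool) × (Fin n → ℕ)) : Prop :=
  (∀ i ≤ n, downCount n pw.1 i ≤ h + upCount n pw.1 i) ∧
  ∀ i : Fin n,
    if pw.1 i then pw.2 i + downCount n pw.1 i ≤ h + upCount n pw.1 i
    else pw.2 i + 1 + downCount n pw.1 i ≤ h + upCount n pw.1 i

theorem isLBPFrom_zero_left {n : ℕ} {pw : (Fin n → Bool) × (Fin n → ℕ)} :
    IsLBPFrom 0 n pw ↔ IsLBP n pw := by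
  simp [IsLBPFrom, IsLBP, IsBallot]

theorem upCount_zero (n : ℕ) (p : Fin n → Bool) : upCount n p 0 = 0 := by simp [upCount]

theorem downCount_zero (n : ℕ) (p : Fin n → Bool) : downCount n p 0 = 0 := by simp [downCount]

theorem upCount_cons (n : ℕ) (b : Bool) (p : Fin n → Bool) (i : ℕ) :
    upCount (n + 1) (Fin.cons b p) (i + 1) = (if b then 1 else 0) + upCount n p i := by
  cases b <;> simp [upCount, Finset.card_filter, Fin.sum_univ_succ, -Finset.sum_boole]

theorem downCount_cons (n : ℕ) (b : Bool) (p : Fin n → Bool) (i : ℕ) :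
    downCount (n + 1) (Fin.cons b p) (i + 1) = (if b then 0 else 1) + downCount n p i := by
  cases b <;> simp [downCount, Finset.card_filter, Fin.sum_univ_succ, -Finset.sum_boole]

theorem isLBPFrom_cons_true {h n a : ℕ} {p : Fin n → Bool} {w : Fin n → ℕ} :
    IsLBPFrom h (n + 1) (Fin.cons true p, Fin.cons a w) ↔
      a < h + 1 ∧ IsLBPFrom (h + 1) n (p, w) := by
  simp only [IsLBPFrom, Fin.forall_fin_succ, Fin.cons_zero, Fin.cons_succ, Fin.val_zero,
    Fin.val_succ, upCount_zero, downCount_zero, upCount_cons, downCount_cons, if_true]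
  constructor
  · rintro ⟨h1, h2, h3⟩
    refine ⟨by omega, fun i hi => ?_, fun i => ?_⟩
    · have := h1 (i + 1) (by omega)
      simp only [upCount_cons, downCount_cons, if_true] at this
      omega
    · have := h3 i
      split_ifs at this ⊢ <;> omega
  · rintro ⟨h1, h2, h3⟩
    refine ⟨fun i hi => ?_, by omega, fun i => ?_⟩
    · cases i with
      | zero => simp [downCount_zero]
      | succ i =>
        have := h2 i (by omega)
        simp only [upCount_cons, downCount_cons, if_true]
        omega
    · have := h3 i
      split_ifs at this ⊢ <;> omega

theorem isLBPFrom_cons_false {h n a : ℕ} {p : Fin n → Bool} {w : Fin n → ℕ} :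
    IsLBPFrom h (n + 1) (Fin.cons false p, Fin.cons a w) ↔
      a < h ∧ IsLBPFrom (h - 1) n (p, w) := by
  simp only [IsLBPFrom, Fin.forall_fin_succ, Fin.cons_zero, Fin.cons_succ, Fin.val_zero,
    Fin.val_succ, upCount_zero, downCount_zero, upCount_cons, downCount_cons, Bool.false_eq_true,
    if_false]
  constructor
  · rintro ⟨h1, h2, h3⟩
    refine ⟨by omega, fun i hi => ?_, fun i => ?_⟩
    · have := h1 (i + 1) (by omega)
      simp only [upCount_cons, downCount_cons, Bool.false_eq_true, if_false] at this
      omega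
    · have := h3 i
      split_ifs at this ⊢ <;> omega
  · rintro ⟨h1, h2, h3⟩
    refine ⟨fun i hi => ?_, by omega, fun i => ?_⟩
    · cases i with
      | zero => simp [downCount_zero]
      | succ i =>
        have := h2 i (by omega)
        simp only [upCount_cons, downCount_cons, Bool.false_eq_true, if_false]
        omega
    · have := h3 i
      split_ifs at this ⊢ <;> omega

/-- A nonempty labeled ballot path amounts to its first step with its label, together with the
remaining labeled ballot path. -/
def lbpFromSuccEquiv (h n : ℕ) :
    {pw : (Fin (n + 1) → Bool) × (Fin (n + 1) → ℕ) // IsLBPFrom h (n + 1) pw} ≃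
      (Fin (h + 1) × {pw : (Fin n → Bool) × (Fin n → ℕ) // IsLBPFrom (h + 1) n pw}) ⊕
      (Fin h × {pw : (Fin n → Bool) × (Fin n → ℕ) // IsLBPFrom (h - 1) n pw}) where
  toFun := fun ⟨(p, w), hpw⟩ =>
    if hb : p 0 = true then
      have H := isLBPFrom_cons_true.1
        (show IsLBPFrom h (n + 1) (Fin.cons true (Fin.tail p), Fin.cons (w 0) (Fin.tail w)) by
          rwa [← hb, Fin.cons_self_tail, Fin.cons_self_tail])
      Sum.inl (⟨w 0, H.1⟩, ⟨(Fin.tail p, Fin.tail w), H.2⟩)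
    else
      have H := isLBPFrom_cons_false.1
        (show IsLBPFrom h (n + 1) (Fin.cons false (Fin.tail p), Fin.cons (w 0) (Fin.tail w)) by
          rwa [← Bool.eq_false_of_not_eq_true hb, Fin.cons_self_tail, Fin.cons_self_tail])
      Sum.inr (⟨w 0, H.1⟩, ⟨(Fin.tail p, Fin.tail w), H.2⟩)
  invFun := Sum.elim
    (fun x => ⟨(Fin.cons true x.2.1.1, Fin.cons x.1.1 x.2.1.2),
      isLBPFrom_cons_true.2 ⟨x.1.2, x.2.2⟩⟩)
    (fun x => ⟨(Fin.cons false x.2.1.1, Fin.cons x.1.1 x.2.1.2),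
      isLBPFrom_cons_false.2 ⟨x.1.2, x.2.2⟩⟩)
  left_inv := by
    rintro ⟨⟨p, w⟩, hpw⟩
    by_cases hb : p 0 = true
    · simp only [hb, dite_true, Sum.elim_inl, Subtype.mk.injEq, Prod.mk.injEq]
      exact ⟨by rw [← hb, Fin.cons_self_tail], Fin.cons_self_tail w⟩
    · simp only [hb, dite_false, Sum.elim_inr, Subtype.mk.injEq, Prod.mk.injEq,
        Bool.false_eq_true]
      exact ⟨by rw [← Bool.eq_false_of_not_eq_true hb, Fin.cons_self_tail], Fin.cons_self_tail w⟩
  right_inv := by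
    rintro (⟨a, ⟨⟨p, w⟩, hpw⟩⟩ | ⟨a, ⟨⟨p, w⟩, hpw⟩⟩) <;> simp

theorem finite_lbpFrom (h n : ℕ) :
    Finite {pw : (Fin n → Bool) × (Fin n → ℕ) // IsLBPFrom h n pw} := by
  induction n generalizing h with
  | zero => infer_instance
  | succ n ih =>
    have := ih (h + 1)
    have := ih (h - 1)
    exact Finite.of_equiv _ (lbpFromSuccEquiv h n).symm

theorem card_lbpFrom (h n : ℕ) :
    (Nat.card {pw : (Fin n → Bool) × (Fin n → ℕ) // IsLBPFrom h n pw} : ℤ) =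
      ((secDeriv ^ n) (X ^ h)).eval 1 := by
  induction n generalizing h with
  | zero =>
    have : Unique {pw : (Fin 0 → Bool) × (Fin 0 → ℕ) // IsLBPFrom h 0 pw} :=
      { default := ⟨(Fin.elim0, Fin.elim0), fun i hi => by simp [downCount], fun i => i.elim0⟩
        uniq := fun a => Subsingleton.elim _ _ }
    simp
  | succ n ih =>
    have := finite_lbpFrom (h + 1) n
    have := finite_lbpFrom (h - 1) n
    rw [Nat.card_congr (lbpFromSuccEquiv h n), Nat.card_sum, Nat.card_prod, Nat.card_prod,
      pow_succ, Module.End.mul_apply, secDeriv_X_pow, map_add, map_nsmul, map_nsmul]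
    simp [ih]

/-! ### Counting snakes -/

/-- The alternating signed words `x < a₁ > a₂ < ⋯` of length `n` with pairwise distinct absolute
values in `A`. -/
def IsSnakeOn (A : Finset ℕ) (x : ℤ) (n : ℕ) (π : Fin n → ℤ) : Prop :=
  Function.Injective (fun i => (π i).natAbs) ∧ (∀ i, (π i).natAbs ∈ A) ∧
    (∀ h : 0 < n, x < π ⟨0, h⟩) ∧ DownUpZ n π

theorem isSnakeOn_Icc_iff {n : ℕ} {π : Fin n → ℤ} :
    IsSnakeOn (Finset.Icc 1 n) 0 n π ↔ IsSnake n π := by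
  simp only [IsSnakeOn, IsSnake, IsSignedPerm, Finset.mem_Icc, and_assoc]

theorem downUpZ_cons_neg {n : ℕ} {b : ℤ} {π : Fin n → ℤ} :
    DownUpZ (n + 1) (Fin.cons b fun i => -π i) ↔
      (∀ h : 0 < n, -b < π ⟨0, h⟩) ∧ DownUpZ n π := by
  constructor
  · intro H
    refine ⟨fun h => ?_, fun i hi => ?_⟩
    · have := H 0 (by omega)
      have e : (⟨0 + 1, by omega⟩ : Fin (n + 1)) = Fin.succ ⟨0, h⟩ := rfl
      rw [e] at this
      simp only [Nat.zero_mod, if_true, Fin.cons_succ, Fin.mk_zero', Fin.cons_zero] at this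
      linarith
    · have := H (i + 1) (by omega)
      have e : (⟨i + 1 + 1, by omega⟩ : Fin (n + 1)) = Fin.succ ⟨i + 1, hi⟩ := rfl
      have e' : (⟨i + 1, by omega⟩ : Fin (n + 1)) = Fin.succ ⟨i, by omega⟩ := rfl
      rw [e, e'] at this
      simp only [Fin.cons_succ, neg_lt_neg_iff] at this
      split_ifs at this ⊢ <;> first | assumption | omega
  · rintro ⟨h0, H⟩ i hi
    cases i with
    | zero =>
      have := h0 (by omega)
      have e : (⟨0 + 1, hi⟩ : Fin (n + 1)) = Fin.succ ⟨0, by omega⟩ := rfl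
      rw [e]
      simp only [Nat.zero_mod, if_true, Fin.cons_succ, Fin.mk_zero', Fin.cons_zero]
      linarith
    | succ i =>
      have := H i (by omega)
      have e : (⟨i + 1 + 1, hi⟩ : Fin (n + 1)) = Fin.succ ⟨i + 1, by omega⟩ := rfl
      have e' : (⟨i + 1, by omega⟩ : Fin (n + 1)) = Fin.succ ⟨i, by omega⟩ := rfl
      rw [e, e']
      simp only [Fin.cons_succ, neg_lt_neg_iff]
      split_ifs at this ⊢ <;> first | assumption | omega

theorem isSnakeOn_cons_neg {A : Finset ℕ} {x b : ℤ} {n : ℕ} {π : Fin n → ℤ} :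
    IsSnakeOn A x (n + 1) (Fin.cons b fun i => -π i) ↔
      (b.natAbs ∈ A ∧ x < b) ∧ IsSnakeOn (A.erase b.natAbs) (-b) n π := by
  have inj : Function.Injective
      (fun i => ((Fin.cons b fun i => -π i : Fin (n + 1) → ℤ) i).natAbs) ↔
      (∀ i, (π i).natAbs ≠ b.natAbs) ∧ Function.Injective fun i => (π i).natAbs := by
    have e : (fun i => ((Fin.cons b fun i => -π i : Fin (n + 1) → ℤ) i).natAbs) =
        (Fin.cons b.natAbs fun i => (π i).natAbs : Fin (n + 1) → ℕ) := by
      funext i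
      refine Fin.cases ?_ (fun i => ?_) i <;> simp
    rw [e, Fin.cons_injective_iff]
    simp
  simp only [IsSnakeOn, inj, downUpZ_cons_neg, Fin.forall_fin_succ, Fin.cons_zero, Fin.cons_succ,
    Int.natAbs_neg, Finset.mem_erase, Fin.mk_zero', Nat.succ_pos, forall_true_left]
  grind

/-- The integers greater than `x` whose absolute value lies in `A`. -/
def signedAbove (A : Finset ℕ) (x : ℤ) : Finset ℤ :=
  (A.image (fun a : ℕ => (a : ℤ)) ∪ A.image (fun a : ℕ => -(a : ℤ))).filter (x < ·)

theorem mem_signedAbove {A : Finset ℕ} {x b : ℤ} :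
    b ∈ signedAbove A x ↔ b.natAbs ∈ A ∧ x < b := by
  simp only [signedAbove, Finset.mem_filter, Finset.mem_union, Finset.mem_image]
  refine and_congr_left fun _ => ⟨?_, fun h => ?_⟩
  · rintro (⟨a, ha, rfl⟩ | ⟨a, ha, rfl⟩) <;> simpa
  · rcases Int.natAbs_eq b with hb | hb
    · exact Or.inl ⟨_, h, hb.symm⟩
    · exact Or.inr ⟨_, h, hb.symm⟩

theorem sum_signedAbove {A : Finset ℕ} (hA : 0 ∉ A) (x : ℤ) (f : ℤ → ℤ) :
    ∑ b ∈ signedAbove A x, f b =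
      ∑ a ∈ A, (if x < a then f a else 0) + ∑ a ∈ A, (if x < -(a : ℤ) then f (-a) else 0) := by
  rw [signedAbove, Finset.sum_filter, Finset.sum_union, Finset.sum_image, Finset.sum_image]
  · intro a _ b _ h
    simpa using h
  · intro a _ b _ h
    simpa using h
  · simp only [Finset.disjoint_left, Finset.mem_image]
    rintro _ ⟨a, ha, rfl⟩ ⟨b, hb, h⟩
    have : a = 0 := by omega
    exact hA (this ▸ ha)

/-- Splitting off the first letter of an alternating signed word and negating the others. -/
def snakeOnSuccEquiv (A : Finset ℕ) (x : ℤ) (n : ℕ) :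
    {π : Fin (n + 1) → ℤ // IsSnakeOn A x (n + 1) π} ≃
      Σ b : signedAbove A x, {π : Fin n → ℤ // IsSnakeOn (A.erase b.1.natAbs) (-b) n π} where
  toFun π :=
    have H := isSnakeOn_cons_neg.1
      (show IsSnakeOn A x (n + 1) (Fin.cons (π.1 0) fun i => - -Fin.tail π.1 i) by
        simpa only [neg_neg, Fin.cons_self_tail] using π.2)
    ⟨⟨π.1 0, mem_signedAbove.2 H.1⟩, ⟨fun i => -Fin.tail π.1 i, H.2⟩⟩
  invFun y := ⟨Fin.cons y.1.1 fun i => -y.2.1 i,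
    isSnakeOn_cons_neg.2 ⟨mem_signedAbove.1 y.1.2, y.2.2⟩⟩
  left_inv π := by
    simp only [neg_neg]
    exact Subtype.ext (Fin.cons_self_tail π.1)
  right_inv y := by
    obtain ⟨⟨b, hb⟩, ⟨π, hπ⟩⟩ := y
    simp only [Fin.tail, Fin.cons_succ, neg_neg]
    rfl

theorem finite_snakeOn (A : Finset ℕ) (x : ℤ) (n : ℕ) :
    Finite {π : Fin n → ℤ // IsSnakeOn A x n π} := by
  induction n generalizing A x with
  | zero => infer_instance
  | succ n ih =>
    have := fun b : signedAbove A x => ih (A.erase b.1.natAbs) (-b)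
    exact Finite.of_equiv _ (snakeOnSuccEquiv A x n).symm

theorem sum_card_filter_lt (A : Finset ℕ) (g : ℕ → ℤ) :
    ∑ a ∈ A, g (A.filter (· < a)).card = ∑ j ∈ Finset.range A.card, g j := by
  induction A using Finset.induction_on_max with
  | empty => simp
  | insert m A hm ih =>
    have hmA : m ∉ A := fun h => lt_irrefl _ (hm m h)
    rw [Finset.sum_insert hmA, Finset.card_insert_of_notMem hmA, Finset.sum_range_succ, ← ih,
      add_comm]
    congr 1
    · refine Finset.sum_congr rfl fun a ha => ?_
      rw [Finset.filter_insert, if_neg (not_lt.2 (hm a ha).le)]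
    · rw [Finset.filter_insert, if_neg (lt_irrefl m), Finset.filter_true_of_mem hm]

theorem sum_ite_lt_card_filter_lt (A : Finset ℕ) (m : ℕ) (g : ℕ → ℤ) :
    ∑ a ∈ A, (if a < m then g (A.filter (· < a)).card else 0) =
      ∑ j ∈ Finset.range (A.filter (· < m)).card, g j := by
  rw [← Finset.sum_filter, ← sum_card_filter_lt]
  refine Finset.sum_congr rfl fun a ha => ?_
  rw [Finset.filter_filter]
  congr 2
  refine Finset.filter_congr fun b _ => ?_
  have := (Finset.mem_filter.1 ha).2
  omega

theorem card_snakeOn {n : ℕ} {A : Finset ℕ} (hn : A.card = n) (hA : 0 ∉ A) {x : ℤ}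
    (hx : x.natAbs ∉ A) :
    (Nat.card {π : Fin n → ℤ // IsSnakeOn A x n π} : ℤ) =
      if 0 ≤ x then snakeNonneg n (A.filter (· < x.natAbs)).card
      else snakeNeg n (A.filter (· < x.natAbs)).card := by
  induction n generalizing A x with
  | zero =>
    have : Unique {π : Fin 0 → ℤ // IsSnakeOn A x 0 π} :=
      { default := ⟨Fin.elim0, fun i => i.elim0, fun i => i.elim0, fun h => absurd h (by omega),
          fun i h => absurd h (by omega)⟩
        uniq := fun a => Subsingleton.elim _ _ }
    obtain rfl := Finset.card_eq_zero.1 hn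
    simp [snakeNonneg, snakeNeg, secPair]
  | succ n ih =>
    have := fun b : signedAbove A x => finite_snakeOn (A.erase b.1.natAbs) (-b) n
    have hr : (A.filter (· < x.natAbs)).card ≤ n + 1 := hn ▸ Finset.card_filter_le _ _
    have erase_filter (a : ℕ) : (A.erase a).filter (· < a) = A.filter (· < a) := by
      ext b
      simp only [Finset.mem_filter, Finset.mem_erase]
      grind
    have hpos : ∀ a ∈ A, (Nat.card {π : Fin n → ℤ // IsSnakeOn (A.erase (a : ℤ).natAbs)
        (-(a : ℤ)) n π} : ℤ) = snakeNeg n (A.filter (· < a)).card := by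
      intro a ha
      have ha0 : a ≠ 0 := fun h => hA (h ▸ ha)
      rw [ih (by simp [Finset.card_erase_of_mem ha, hn]) (by simp [hA]) (by simp),
        if_neg (by omega)]
      simp [erase_filter]
    have hneg : ∀ a ∈ A, (Nat.card {π : Fin n → ℤ // IsSnakeOn (A.erase (-(a : ℤ)).natAbs)
        (-(-(a : ℤ))) n π} : ℤ) = snakeNonneg n (A.filter (· < a)).card := by
      intro a ha
      rw [ih (by simp [Finset.card_erase_of_mem ha, hn]) (by simp [hA]) (by simp),
        if_pos (by omega)]
      simp [erase_filter]
    rw [Nat.card_congr (snakeOnSuccEquiv A x n), Nat.card_sigma, Nat.cast_sum,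
      Finset.sum_coe_sort (signedAbove A x) (fun b =>
        (Nat.card {π : Fin n → ℤ // IsSnakeOn (A.erase b.natAbs) (-b) n π} : ℤ)),
      sum_signedAbove hA]
    split_ifs with h0
    · rw [snakeNonneg_succ_eq_zero_sub hr, snakeNonneg_succ_zero, ← hn, ← sum_card_filter_lt,
        ← sum_ite_lt_card_filter_lt, ← Finset.sum_sub_distrib,
        Finset.sum_eq_zero (s := A) (f := fun a => if x < -(a : ℤ) then _ else _), add_zero]
      · refine Finset.sum_congr rfl fun a ha => ?_
        have hax : a ≠ x.natAbs := fun h => hx (h ▸ ha)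
        rw [hpos a ha]
        split_ifs <;> omega
      · intro a _
        rw [if_neg (by omega)]
    · rw [snakeNeg_succ_eq hr, snakeNonneg_succ_zero, ← hn, ← sum_card_filter_lt,
        ← sum_ite_lt_card_filter_lt]
      congr 1
      · refine Finset.sum_congr rfl fun a ha => ?_
        rw [hpos a ha, if_pos (by omega)]
      · refine Finset.sum_congr rfl fun a ha => ?_
        rw [hneg a ha]
        split_ifs <;> omega

theorem card_snake (n : ℕ) :
    (Nat.card {π : Fin n → ℤ // IsSnake n π} : ℤ) = ((secDeriv ^ n) 1).eval 1 := by
  rw [← Nat.card_congr (Equiv.subtypeEquivRight fun _ => isSnakeOn_Icc_iff),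
    card_snakeOn (by simp) (by simp) (by simp)]
  simp [snakeNonneg, secPair]

theorem card_lbp (n : ℕ) :
    (Nat.card {pw : (Fin n → Bool) × (Fin n → ℕ) // IsLBP n pw} : ℤ) =
      ((secDeriv ^ n) 1).eval 1 := by
  rw [← Nat.card_congr (Equiv.subtypeEquivRight fun _ => isLBPFrom_zero_left), card_lbpFrom,
    pow_zero]

/-- For every positive integer `n` there is a bijection between the set
`𝒮ₙ` of snakes of length `n` and the set `𝒫ₙ` of labeled ballot paths of length `n`;
in particular `|𝒮ₙ| = |𝒫ₙ|`. -/
theorem snake_equiv_lbp (n : ℕ) (hn : 0 < n) :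
    Nonempty ({π : Fin n → ℤ // IsSnake n π} ≃
      {pw : (Fin n → Bool) × (Fin n → ℕ) // IsLBP n pw}) ∧
    Nat.card {π : Fin n → ℤ // IsSnake n π} =
      Nat.card {pw : (Fin n → Bool) × (Fin n → ℕ) // IsLBP n pw} := by
  have hcard : Nat.card {π : Fin n → ℤ // IsSnake n π} =
      Nat.card {pw : (Fin n → Bool) × (Fin n → ℕ) // IsLBP n pw} := by
    exact_mod_cast (card_snake n).trans (card_lbp n).symm
  have : Finite {π : Fin n → ℤ // IsSnake n π} :=
    have := finite_snakeOn (Finset.Icc 1 n) 0 n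
    Finite.of_equiv _ (Equiv.subtypeEquivRight fun _ => isSnakeOn_Icc_iff)
  have : Finite {pw : (Fin n → Bool) × (Fin n → ℕ) // IsLBP n pw} :=
    have := finite_lbpFrom 0 n
    Finite.of_equiv _ (Equiv.subtypeEquivRight fun _ => isLBPFrom_zero_left)
  exact ⟨Finite.card_eq.1 hcard, hcard⟩
end

section
/- For every positive integer n, there exists a bijection between the set 𝔚_n of weakly increasing 3-dimensional permutations of length n and the set ℜ_n of rc-invariant alternating permutations of {1,…,2n}; in particular |𝔚_n| = |ℜ_n|. -/
/-- A weakly increasing 3-dimensional permutation of length `n`: a pair `(σ, π)`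
of permutations with `max (σ i) (π i)` weakly increasing in `i`. -/
def IsWIP3 (n : ℕ) (p : Equiv.Perm (Fin n) × Equiv.Perm (Fin n)) : Prop :=
  ∀ i j : Fin n, i ≤ j → max (p.1 i) (p.2 i) ≤ max (p.1 j) (p.2 j)

/-- `a : Fin N → ℕ` represents a permutation of `{1, …, N}` (written in one-line notation,
positions `0`-indexed): it is injective with values in `{1, …, N}`. -/
def IsPermOn (N : ℕ) (a : Fin N → ℕ) : Prop :=
  Function.Injective a ∧ ∀ i, a i ∈ Finset.Icc 1 N

/-- The down-up (alternating) property `a₁ > a₂ < a₃ > a₄ < ⋯` (positions `0`-indexed). -/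
def DownUpN (N : ℕ) (a : Fin N → ℕ) : Prop :=
  ∀ i : ℕ, ∀ h : i + 1 < N,
    if i % 2 = 0 then a ⟨i + 1, h⟩ < a ⟨i, by omega⟩
    else a ⟨i, by omega⟩ < a ⟨i + 1, h⟩

/-- rc-invariance: `a_{N+1-i} = N+1 - a_i` (in `1`-based positions), i.e. the permutation
equals its reverse-complement. -/
def RCInv (N : ℕ) (a : Fin N → ℕ) : Prop :=
  ∀ i : Fin N, a ⟨N - 1 - (i : ℕ), by have := i.isLt; omega⟩ = N + 1 - a i

/-- An rc-invariant alternating permutation of `{1, …, 2n}`. -/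
def IsRCAlt (n : ℕ) (a : Fin (2 * n) → ℕ) : Prop :=
  IsPermOn (2 * n) a ∧ DownUpN (2 * n) a ∧ RCInv (2 * n) a

open Finset Equiv

/-- The cyclic valleys of a permutation. -/
def cycValleys {n : ℕ} (e : Perm (Fin n)) : Finset (Fin n) :=
  {m | m < e m ∧ m < e.symm m}

/-- The valleys of a permutation read as a word, where the word is preceded by a letter smaller
than all others and followed by a letter larger than all others. -/
def wordValleys {n : ℕ} (w : Perm (Fin n)) : Finset (Fin n) :=
  {j | (∃ k : Fin n, (k : ℕ) + 1 = j ∧ w j < w k) ∧ ∀ k : Fin n, (k : ℕ) = j + 1 → w j < w k}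

/-- Summing over the `n` places where a new minimum becomes a valley: at the places in `A ∪ B` it
destroys an old valley. -/
lemma sum_apply_ite_mem_or {n v : ℕ} (f : ℕ → ℕ) {A B : Finset (Fin n)} (hAB : Disjoint A B)
    (hA : #A = v) (hB : #B = v) :
    ∑ q, f (if q ∈ A ∨ q ∈ B then v else v + 1) = 2 * v * f v + (n - 2 * v) * f (v + 1) := by
  have hc : #(A ∪ B) = 2 * v := by rw [card_union_of_disjoint hAB]; omega
  rw [← sum_add_sum_compl (A ∪ B)]
  congr 1
  · rw [sum_congr rfl (g := fun _ => f v), sum_const, hc, smul_eq_mul]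
    intro q hq
    rw [if_pos (mem_union.1 hq)]
  · rw [sum_congr rfl (g := fun _ => f (v + 1)), sum_const, card_compl, hc, smul_eq_mul,
      Fintype.card_fin]
    intro q hq
    rw [if_neg (by simpa using hq)]

lemma cycValleys_disjoint_map {n : ℕ} (e : Perm (Fin n)) :
    Disjoint (cycValleys e) ((cycValleys e).map e.toEmbedding) := by
  rw [Finset.disjoint_left]
  intro q hq hq'
  obtain ⟨m, hm, rfl⟩ := mem_map.1 hq'
  simp only [cycValleys, mem_filter, mem_univ, true_and] at hq hm
  simp at hq
  exact absurd (hq.2.trans hm.1) (lt_irrefl _)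

lemma card_cycValleys_decomposeFin_zero {n : ℕ} (e : Perm (Fin n)) :
    #(cycValleys (Perm.decomposeFin.symm (0, e))) = #(cycValleys e) := by
  have hs : ∀ m : Fin n, (Perm.decomposeFin.symm (0, e)).symm m.succ = (e.symm m).succ := by
    intro m
    rw [Equiv.symm_apply_eq]
    simp
  have : cycValleys (Perm.decomposeFin.symm (0, e)) = (cycValleys e).map (Fin.succEmb n) := by
    ext m
    cases m using Fin.cases with
    | zero => simp [cycValleys]
    | succ m => simp [cycValleys, hs]
  rw [this, card_map]

lemma card_cycValleys_decomposeFin_succ {n : ℕ} (e : Perm (Fin n)) (q : Fin n) :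
    #(cycValleys (Perm.decomposeFin.symm (q.succ, e))) =
      if q ∈ cycValleys e ∨ q ∈ (cycValleys e).map e.toEmbedding then #(cycValleys e)
        else #(cycValleys e) + 1 := by
  set τ := Perm.decomposeFin.symm (q.succ, e) with hτ
  have h0 : τ 0 = q.succ := by simp [hτ]
  have h0' : τ.symm 0 = (e.symm q).succ := by
    rw [Equiv.symm_apply_eq]; simp [hτ]
  have h1 : ∀ m, e m = q → τ m.succ = 0 := by
    intro m hm; simp [hτ, hm]
  have h1' : ∀ m, e m ≠ q → τ m.succ = (e m).succ := by
    intro m hm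
    simp only [hτ, Perm.decomposeFin_symm_apply_succ]
    exact Equiv.swap_apply_of_ne_of_ne (Fin.succ_ne_zero _) (by simpa using hm)
  have h2 : τ.symm q.succ = 0 := by rw [Equiv.symm_apply_eq, h0]
  have h2' : ∀ m, m ≠ q → τ.symm m.succ = (e.symm m).succ := by
    intro m hm
    rw [Equiv.symm_apply_eq, h1' _ (by simpa using hm)]; simp
  have key : cycValleys τ =
      insert 0 ((((cycValleys e).erase q).erase (e.symm q)).map (Fin.succEmb n)) := by
    ext m
    cases m using Fin.cases with
    | zero => simp [cycValleys, h0, h0']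
    | succ m =>
      by_cases hm : m = q
      · subst hm; simp [cycValleys, h2]
      · by_cases hm' : e m = q
        · have : e.symm q = m := by simp [← hm']
          simp [cycValleys, h1 _ hm', this]
        · have : m ≠ e.symm q := fun h => hm' (by simp [h])
          simp [cycValleys, h1' _ hm', h2' _ hm, hm, this]
  have hmap : q ∈ (cycValleys e).map e.toEmbedding ↔ e.symm q ∈ cycValleys e := by
    simp [Finset.mem_map_equiv]
  have hd : q ∈ cycValleys e → q ∉ (cycValleys e).map e.toEmbedding :=
    fun h => Finset.disjoint_left.1 (cycValleys_disjoint_map e) h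
  rw [key, card_insert_of_notMem (by simp), card_map]
  rw [hmap] at hd
  by_cases hq : q ∈ cycValleys e
  · rw [erase_eq_of_notMem (a := e.symm q) (fun h => hd hq (mem_of_mem_erase h)), if_pos (.inl hq),
      card_erase_add_one hq]
  · rw [erase_eq_of_notMem hq]
    by_cases hq' : e.symm q ∈ cycValleys e
    · rw [if_pos (.inr (hmap.2 hq')), card_erase_add_one hq']
    · rw [if_neg (by tauto), erase_eq_of_notMem hq']

lemma sum_card_cycValleys_succ (n : ℕ) (f : ℕ → ℕ) :
    ∑ e : Perm (Fin (n + 1)), f #(cycValleys e) =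
      ∑ e : Perm (Fin n), (f #(cycValleys e) + (2 * #(cycValleys e) * f #(cycValleys e) +
        (n - 2 * #(cycValleys e)) * f (#(cycValleys e) + 1))) := by
  rw [← Equiv.sum_comp Perm.decomposeFin.symm, Fintype.sum_prod_type_right]
  refine sum_congr rfl fun e _ => ?_
  rw [Fin.sum_univ_succ, card_cycValleys_decomposeFin_zero]
  simp only [card_cycValleys_decomposeFin_succ]
  rw [sum_apply_ite_mem_or f (cycValleys_disjoint_map e) rfl (card_map _)]

/-- Insert a new minimal letter at position `i` of the word `w`. -/
def insertMin {n : ℕ} (i : Fin (n + 1)) (w : Perm (Fin n)) : Perm (Fin (n + 1)) :=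
  (finSuccEquiv' i).trans ((optionCongr w).trans (finSuccEquiv' 0).symm)

lemma insertMin_self {n : ℕ} (i : Fin (n + 1)) (w : Perm (Fin n)) : insertMin i w i = 0 := by
  simp [insertMin]

lemma insertMin_succAbove {n : ℕ} (i : Fin (n + 1)) (w : Perm (Fin n)) (j : Fin n) :
    insertMin i w (i.succAbove j) = (w j).succ := by
  simp [insertMin]

lemma bijective_insertMin (n : ℕ) :
    Function.Bijective fun x : Fin (n + 1) × Perm (Fin n) => insertMin x.1 x.2 := by
  rw [Fintype.bijective_iff_injective_and_card]
  refine ⟨?_, by simp [Fintype.card_perm, Nat.factorial_succ]⟩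
  rintro ⟨i, w⟩ ⟨i', w'⟩ h
  simp only at h
  obtain rfl : i = i' := by
    apply (insertMin i' w').injective
    rw [insertMin_self, ← h, insertMin_self]
  congr 1
  ext j
  have := congrArg (fun σ => σ (i.succAbove j)) h
  simpa [insertMin_succAbove] using congrArg Fin.val this

lemma succAbove_mem_wordValleys_insertMin {n : ℕ} (i : Fin (n + 1)) (w : Perm (Fin n))
    (j : Fin n) : i.succAbove j ∈ wordValleys (insertMin i w) ↔
      j ∈ wordValleys w ∧ (j : ℕ) + 1 ≠ i ∧ (j : ℕ) ≠ i := by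
  have hv : ∀ k : Fin n, (i.succAbove k : ℕ) = if (k : ℕ) < i then (k : ℕ) else k + 1 := by
    intro k
    simp only [Fin.succAbove, Fin.lt_def, Fin.val_castSucc]
    split_ifs <;> simp
  simp only [wordValleys, mem_filter, mem_univ, true_and, insertMin_succAbove]
  rw [Fin.exists_iff_succAbove i, Fin.forall_iff_succAbove i]
  simp only [insertMin_self, insertMin_succAbove, Fin.succ_lt_succ_iff, hv, Fin.not_lt_zero]
  constructor
  · rintro ⟨h1, h2, h3⟩
    have hne : (j : ℕ) + 1 ≠ i := by intro h; apply h2; rw [if_pos] <;> omega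
    obtain ⟨k, hk, hk'⟩ := h1.resolve_left (by simp)
    have hkj : (k : ℕ) + 1 = j ∧ (j : ℕ) ≠ i := by split_ifs at hk <;> omega
    refine ⟨⟨⟨k, hkj.1, hk'⟩, fun k hk => h3 k ?_⟩, hne, hkj.2⟩
    split_ifs <;> omega
  · rintro ⟨⟨⟨k, hk, hk'⟩, h2⟩, h3, h4⟩
    refine ⟨.inr ⟨k, ?_, hk'⟩, ?_, fun k hk => h2 k ?_⟩
    · split_ifs <;> omega
    · split_ifs <;> omega
    · split_ifs at hk <;> omega

/-- The positions immediately before a valley. -/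
def prevWordValleys {n : ℕ} (w : Perm (Fin n)) : Finset (Fin n) :=
  {k | ∃ j ∈ wordValleys w, (k : ℕ) + 1 = j}

lemma card_prevWordValleys {n : ℕ} (w : Perm (Fin n)) :
    #(prevWordValleys w) = #(wordValleys w) := by
  rw [← card_map (Fin.valEmbedding.trans (addRightEmbedding 1)),
    ← card_map (s := wordValleys w) Fin.valEmbedding]
  congr 1
  ext x
  simp only [mem_map, prevWordValleys, mem_filter, mem_univ, true_and,
    Function.Embedding.trans_apply,
    Fin.valEmbedding_apply, addRightEmbedding_apply]
  constructor
  · rintro ⟨k, ⟨j, hj, hkj⟩, rfl⟩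
    exact ⟨j, hj, hkj.symm⟩
  · rintro ⟨j, hj, rfl⟩
    have hj' := hj
    simp only [wordValleys, mem_filter, mem_univ, true_and] at hj'
    obtain ⟨⟨k, hk, -⟩, -⟩ := hj'
    exact ⟨k, ⟨j, hj, hk⟩, hk⟩

lemma disjoint_prevWordValleys {n : ℕ} (w : Perm (Fin n)) :
    Disjoint (wordValleys w) (prevWordValleys w) := by
  rw [Finset.disjoint_left]
  intro q hq hq'
  simp only [prevWordValleys, wordValleys, mem_filter, mem_univ, true_and] at hq hq'
  obtain ⟨j, ⟨⟨k, hk, hlt⟩, -⟩, hj⟩ := hq'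
  obtain rfl : k = q := by ext; omega
  exact absurd (hlt.trans (hq.2 j hj.symm)) (lt_irrefl _)

lemma card_wordValleys_insertMin_zero {n : ℕ} (w : Perm (Fin n)) :
    #(wordValleys (insertMin 0 w)) = #(wordValleys w) := by
  have : wordValleys (insertMin 0 w) = (wordValleys w).map (Fin.succAboveEmb 0) := by
    ext m
    cases m using Fin.succAboveCases 0 with
    | x => simp [wordValleys]
    | p j =>
      rw [succAbove_mem_wordValleys_insertMin, ← Fin.succAboveEmb_apply, mem_map']
      simp only [wordValleys, mem_filter, mem_univ, true_and, Fin.val_zero]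
      constructor
      · tauto
      · rintro ⟨⟨k, hk, h⟩, h'⟩
        exact ⟨⟨⟨k, hk, h⟩, h'⟩, by omega, by omega⟩
  rw [this, card_map]

lemma card_wordValleys_insertMin_succ {n : ℕ} (w : Perm (Fin n)) (q : Fin n) :
    #(wordValleys (insertMin q.succ w)) =
      if q ∈ wordValleys w ∨ q ∈ prevWordValleys w then #(wordValleys w)
        else #(wordValleys w) + 1 := by
  have key : wordValleys (insertMin q.succ w) =
      insert q.succ (({j ∈ wordValleys w | (j : ℕ) ≠ q ∧ (j : ℕ) ≠ q + 1} : Finset (Fin n)).map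
        (Fin.succAboveEmb q.succ)) := by
    ext m
    cases m using Fin.succAboveCases q.succ with
    | x =>
      simp only [mem_insert, true_or, iff_true]
      simp only [wordValleys, mem_filter, mem_univ, true_and, insertMin_self]
      have : ∀ k, k ≠ q.succ → 0 < insertMin q.succ w k := by
        intro k hk
        rw [Fin.pos_iff_ne_zero, ← insertMin_self q.succ w]
        exact (insertMin q.succ w).injective.ne hk
      refine ⟨⟨q.castSucc, by simp, this _ ?_⟩, fun k hk => this _ ?_⟩
      · intro h; simpa using congrArg Fin.val h
      · rintro rfl; omega
    | p j =>
      rw [succAbove_mem_wordValleys_insertMin, mem_insert, ← Fin.succAboveEmb_apply, mem_map']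
      simp only [mem_filter, Fin.succAboveEmb_apply, Fin.succAbove_ne, false_or, Fin.val_succ]
      simp
  rw [key, card_insert_of_notMem (by simp [Fin.succAbove_ne]), card_map]
  have hd : q ∈ wordValleys w → q ∉ prevWordValleys w :=
    fun h => Finset.disjoint_left.1 (disjoint_prevWordValleys w) h
  by_cases hq : q ∈ wordValleys w
  · rw [if_pos (.inl hq), ← card_erase_add_one hq]
    congr 2
    ext j
    simp only [mem_filter, mem_erase, Fin.ext_iff, ne_eq]
    have : j ∈ wordValleys w → (j : ℕ) ≠ q + 1 := fun hj h =>
      hd hq (by simp only [prevWordValleys, mem_filter, mem_univ, true_and]; exact ⟨j, hj, h.symm⟩)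
    tauto
  · by_cases hq' : q ∈ prevWordValleys w
    · rw [if_pos (.inr hq')]
      simp only [prevWordValleys, mem_filter, mem_univ, true_and] at hq'
      obtain ⟨j, hj, hqj⟩ := hq'
      rw [← card_erase_add_one hj]
      congr 2
      ext k
      simp only [mem_filter, mem_erase, ne_eq]
      have : k ∈ wordValleys w → (k : ℕ) ≠ q := fun hk h => hq (by rwa [← Fin.ext h])
      rw [Fin.ext_iff, hqj]
      tauto
    · rw [if_neg (by tauto), filter_true_of_mem]
      intro j hj
      refine ⟨fun h => hq (by rwa [← Fin.ext h]), fun h => hq' ?_⟩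
      simp only [prevWordValleys, mem_filter, mem_univ, true_and]
      exact ⟨j, hj, h.symm⟩

lemma sum_card_wordValleys_succ (n : ℕ) (f : ℕ → ℕ) :
    ∑ w : Perm (Fin (n + 1)), f #(wordValleys w) =
      ∑ w : Perm (Fin n), (f #(wordValleys w) + (2 * #(wordValleys w) * f #(wordValleys w) +
        (n - 2 * #(wordValleys w)) * f (#(wordValleys w) + 1))) := by
  rw [← (bijective_insertMin n).sum_comp, Fintype.sum_prod_type_right]
  refine sum_congr rfl fun w _ => ?_
  rw [Fin.sum_univ_succ, card_wordValleys_insertMin_zero]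
  simp only [card_wordValleys_insertMin_succ]
  rw [sum_apply_ite_mem_or f (disjoint_prevWordValleys w) rfl (card_prevWordValleys w)]

/-- Cyclic valleys and word valleys are equidistributed. -/
theorem sum_card_cycValleys_eq_sum_card_wordValleys (n : ℕ) (f : ℕ → ℕ) :
    ∑ e : Perm (Fin n), f #(cycValleys e) = ∑ w : Perm (Fin n), f #(wordValleys w) := by
  induction n generalizing f with
  | zero => simp [Subsingleton.elim (cycValleys _) ∅, Subsingleton.elim (wordValleys _) ∅]
  | succ n ih =>
    rw [sum_card_cycValleys_succ, sum_card_wordValleys_succ,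
      ih fun v => f v + (2 * v * f v + (n - 2 * v) * f (v + 1))]

/-- The cyclic peaks of a permutation. -/
def cycPeaks {n : ℕ} (e : Perm (Fin n)) : Finset (Fin n) :=
  {m | e m < m ∧ e.symm m < m}

lemma sum_card_cycPeaks (n : ℕ) (f : ℕ → ℕ) :
    ∑ e : Perm (Fin n), f #(cycPeaks e) = ∑ e : Perm (Fin n), f #(cycValleys e) := by
  rw [← Equiv.sum_comp (permCongr Fin.revPerm)]
  refine sum_congr rfl fun e _ => ?_
  rw [← card_map (s := cycValleys e) Fin.revPerm.toEmbedding]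
  congr 2
  ext m
  rw [Finset.mem_map_equiv]
  simp only [cycPeaks, cycValleys, mem_filter, mem_univ, true_and, permCongr_apply,
    Fin.revPerm_symm, Fin.revPerm_apply]
  have h1 := Fin.rev_lt_iff (i := e m.rev) (j := m)
  have h2 := Fin.rev_lt_iff (i := e.symm m.rev) (j := m)
  rw [h1]
  exact and_congr_right fun _ => h2

/-- The number of columns `(v, e v)` with a given maximum is at most two, and it is two exactly
at the cyclic peaks. -/
lemma factorial_card_fiber_max {n : ℕ} (e : Perm (Fin n)) (m : Fin n) :
    (Fintype.card {v // max v (e v) = m}).factorial = if m ∈ cycPeaks e then 2 else 1 := by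
  rw [Fintype.card_subtype]
  have hsub : ∀ v, max v (e v) = m → v = m ∨ v = e.symm m := by
    intro v hv
    rcases max_choice v (e v) with h | h
    · left; rw [← hv, h]
    · right; rw [← hv, h]; simp
  split_ifs with h
  · simp only [cycPeaks, mem_filter, mem_univ, true_and] at h
    have : ({v | max v (e v) = m} : Finset (Fin n)) = {m, e.symm m} := by
      ext v
      simp only [mem_filter, mem_univ, true_and, mem_insert, mem_singleton]
      refine ⟨hsub v, ?_⟩
      rintro (rfl | rfl)
      · exact max_eq_left h.1.le
      · simpa using h.2.le
    rw [this, card_pair h.2.ne']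
    rfl
  · rw [Nat.factorial_eq_one, Finset.card_le_one]
    simp only [cycPeaks, mem_filter, mem_univ, true_and] at h ⊢
    have key : ∀ a b, max a (e a) = m → max b (e b) = m → a = m → b = e.symm m → a = b := by
      rintro a b ha hb rfl rfl
      by_contra hne
      apply h
      have h1 : e a ≤ a := (le_max_right _ _).trans_eq ha
      have h2 : e.symm a ≤ a := (le_max_left _ _).trans_eq hb
      refine ⟨lt_of_le_of_ne h1 fun h => hne ?_, lt_of_le_of_ne h2 (Ne.symm hne)⟩
      rw [Equiv.eq_symm_apply, h]
    intro a ha b hb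
    rcases hsub a ha with h1 | h1 <;> rcases hsub b hb with h2 | h2
    · rw [h1, h2]
    · exact key a b ha hb h1 h2
    · exact (key b a hb ha h2 h1).symm
    · rw [h1, h2]

/-- The rearrangements making a tuple monotone are counted by its multiplicities. -/
lemma card_perm_monotone_comp {n : ℕ} {α : Type*} [LinearOrder α] [Fintype α] (g : Fin n → α) :
    Nat.card {σ : Perm (Fin n) // Monotone (g ∘ σ)} =
      ∏ i, (Fintype.card {a // g a = i}).factorial := by
  rw [← DomMulAct.stabilizer_card, ← Nat.card_eq_fintype_card]
  refine Nat.card_congr ((Equiv.mulRight (Tuple.sort g)⁻¹).subtypeEquiv fun σ => ?_)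
  rw [← Tuple.comp_sort_eq_comp_iff_monotone]
  simp only [funext_iff, Function.comp_apply, Equiv.coe_mulRight, Perm.mul_apply]
  constructor
  · intro h a
    simpa using h ((Tuple.sort g)⁻¹ a)
  · intro h a
    simpa using h (Tuple.sort g a)

/-- A weakly increasing 3-dimensional permutation `(σ, π)` amounts to the permutation `e = π σ⁻¹`
and an ordering `σ` of the columns `(v, e v)` with weakly increasing maxima. -/
def wipEquivSigma (n : ℕ) : {p : Perm (Fin n) × Perm (Fin n) // IsWIP3 n p} ≃
    Σ e : Perm (Fin n), {σ : Perm (Fin n) // Monotone ((fun v => max v (e v)) ∘ σ)} :=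
  (Equiv.subtypeEquiv
    { toFun := fun p => (p.2 * p.1⁻¹, p.1)
      invFun := fun x => (x.2, x.1 * x.2)
      left_inv := fun p => by simp
      right_inv := fun x => by simp }
    (fun p => by simp [IsWIP3, Monotone])).trans
    (Equiv.subtypeProdEquivSigmaSubtype
      fun e σ : Perm (Fin n) => Monotone ((fun v => max v (e v)) ∘ σ))

lemma card_wip (n : ℕ) :
    Nat.card {p : Perm (Fin n) × Perm (Fin n) // IsWIP3 n p} =
      ∑ e : Perm (Fin n), 2 ^ #(cycPeaks e) := by
  rw [Nat.card_congr (wipEquivSigma n), Nat.card_sigma]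
  refine sum_congr rfl fun e _ => ?_
  rw [card_perm_monotone_comp]
  simp only [factorial_card_fiber_max]
  rw [prod_ite_mem, univ_inter, prod_const]

/-- The value at distance `x` from the centre of `{1, …, 2n}`, above the centre unless exactly
one of `¬ P` and `p` holds. -/
def signedValue (n : ℕ) (P p : Prop) [Decidable P] [Decidable p] (x : ℕ) : ℕ :=
  if P ↔ ¬ p then n + 1 + x else n - x

lemma signedValue_mem_Icc {n x : ℕ} (P p : Prop) [Decidable P] [Decidable p] (hx : x < n) :
    signedValue n P p x ∈ Icc 1 (2 * n) := by
  unfold signedValue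
  rw [mem_Icc]
  split_ifs <;> omega

lemma signedValue_not {n x : ℕ} {P Q p : Prop} [Decidable P] [Decidable Q] [Decidable p]
    (hx : x < n) (hQ : Q ↔ ¬ P) :
    signedValue n Q p x = 2 * n + 1 - signedValue n P p x := by
  unfold signedValue
  by_cases P <;> by_cases p <;> simp_all <;> omega

lemma signedValue_inj {n x y : ℕ} {P Q p q : Prop} [Decidable P] [Decidable Q] [Decidable p]
    [Decidable q] (hx : x < n) (hy : y < n) (h : signedValue n P p x = signedValue n Q q y) :
    x = y ∧ ((P ↔ ¬ p) ↔ (Q ↔ ¬ q)) := by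
  unfold signedValue at h
  split_ifs at h with h1 h2 h2
  · exact ⟨by omega, by tauto⟩
  · omega
  · omega
  · exact ⟨by omega, by tauto⟩

lemma signedValue_alternating_iff {n x y : ℕ} {P Q p q : Prop} [Decidable P] [Decidable Q]
    [Decidable p] [Decidable q] (hx : x < n) (hy : y < n) (hQ : Q ↔ ¬ P) :
    (if P then signedValue n Q q y < signedValue n P p x
      else signedValue n P p x < signedValue n Q q y) ↔ (p → x < y) ∧ (q → y < x) := by
  unfold signedValue
  by_cases P <;> by_cases p <;> by_cases q <;> simp_all <;> omega

/-- The distance of a position of `{1, …, 2n}` from the centre. -/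
def foldFin {n : ℕ} (i : Fin (2 * n)) : Fin n :=
  ⟨if n ≤ i then i - n else n - 1 - i, by split_ifs <;> omega⟩

/-- The position of the right half at distance `j` from the centre. -/
def rightFin {n : ℕ} (j : Fin n) : Fin (2 * n) := ⟨n + j, by omega⟩

lemma foldFin_rightFin {n : ℕ} (j : Fin n) : foldFin (rightFin j) = j := by
  ext; simp [foldFin, rightFin]

/-- The rc-invariant word with distances `w` from the centre, where the letters at distances
in `s` are on the other side of the centre than the alternating pattern suggests. -/
def rcWord {n : ℕ} (w : Perm (Fin n)) (s : Finset (Fin n)) (i : Fin (2 * n)) : ℕ :=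
  signedValue n ((i : ℕ) % 2 = 0) (foldFin i ∈ s) (w (foldFin i))

lemma isPermOn_rcWord {n : ℕ} (w : Perm (Fin n)) (s : Finset (Fin n)) :
    IsPermOn (2 * n) (rcWord w s) := by
  refine ⟨fun i i' h => ?_, fun i => signedValue_mem_Icc _ _ (w _).isLt⟩
  obtain ⟨h1, h2⟩ := signedValue_inj (w _).isLt (w _).isLt h
  have h3 : foldFin i = foldFin i' := w.injective (Fin.ext h1)
  rw [h3] at h2
  have h4 : (i : ℕ) % 2 = 0 ↔ (i' : ℕ) % 2 = 0 := by tauto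
  have h5 := congrArg Fin.val h3
  simp only [foldFin] at h5
  ext
  split_ifs at h5 <;> omega

lemma rcInv_rcWord {n : ℕ} (w : Perm (Fin n)) (s : Finset (Fin n)) :
    RCInv (2 * n) (rcWord w s) := by
  intro i
  have : foldFin ⟨2 * n - 1 - i, by omega⟩ = foldFin i := by
    ext
    simp only [foldFin]
    split_ifs <;> omega
  unfold rcWord
  simp only [this]
  exact signedValue_not (w _).isLt (by omega)

lemma downUpN_rcWord_iff {n : ℕ} (w : Perm (Fin n)) (s : Finset (Fin n)) :
    DownUpN (2 * n) (rcWord w s) ↔ s ⊆ wordValleys w := by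
  have hstep : DownUpN (2 * n) (rcWord w s) ↔ ∀ i : ℕ, ∀ h : i + 1 < 2 * n,
      (foldFin ⟨i, by omega⟩ ∈ s → w (foldFin ⟨i, by omega⟩) < w (foldFin ⟨i + 1, h⟩)) ∧
      (foldFin ⟨i + 1, h⟩ ∈ s → w (foldFin ⟨i + 1, h⟩) < w (foldFin ⟨i, by omega⟩)) :=
    forall₂_congr fun i h =>
      signedValue_alternating_iff (w _).isLt (w _).isLt (by simp only; omega)
  have hval : ∀ i : Fin (2 * n),
      (foldFin i : ℕ) = if n ≤ (i : ℕ) then (i : ℕ) - n else n - 1 - i := fun _ => rfl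
  rw [hstep]
  constructor
  · intro H j hj
    have hr : ∀ k : Fin n, (h : n + k < 2 * n) → foldFin ⟨n + k, h⟩ = k :=
      fun k _ => foldFin_rightFin k
    simp only [wordValleys, mem_filter, mem_univ, true_and]
    constructor
    · have hj0 : (j : ℕ) ≠ 0 := by
        intro h0
        have h1 : foldFin ⟨n - 1, by omega⟩ = j := by
          ext; rw [hval]; simp only; split_ifs <;> omega
        have h2 : foldFin ⟨n - 1 + 1, by omega⟩ = j := by
          ext; rw [hval]; simp only; split_ifs <;> omega
        have := (H (n - 1) (by omega)).1
        rw [h1, h2] at this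
        exact lt_irrefl _ (this hj)
      have h1 : foldFin (⟨n + j - 1, by omega⟩ : Fin (2 * n)) = ⟨j - 1, by omega⟩ := by
        ext; rw [hval]; simp only; split_ifs <;> omega
      have h2 : foldFin ⟨n + j - 1 + 1, by omega⟩ = j := by
        ext; rw [hval]; simp only; split_ifs <;> omega
      have := (H (n + j - 1) (by omega)).2
      rw [h1, h2] at this
      refine ⟨⟨j - 1, by omega⟩, ?_, this hj⟩
      simp only
      omega
    · intro k hk
      have h2 : foldFin ⟨n + j + 1, by omega⟩ = k := by
        ext; rw [hval]; simp only; split_ifs <;> omega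
      have := (H (n + j) (by omega)).1
      rw [hr, h2] at this
      exact this hj
  · intro H i h
    have key : ∀ j k : Fin n, ((k : ℕ) + 1 = j ∨ (k : ℕ) = j + 1 ∨ ((j : ℕ) = 0 ∧ k = j)) →
        j ∈ s → w j < w k := by
      intro j k hjk hj
      have hV := H hj
      simp only [wordValleys, mem_filter, mem_univ, true_and] at hV
      obtain ⟨⟨l, hl, hlt⟩, hV⟩ := hV
      rcases hjk with hk | hk | hk
      · obtain rfl : k = l := by ext; omega
        exact hlt
      · exact hV k hk
      · omega
    constructor <;> apply key <;> rw [Fin.ext_iff, hval, hval] <;> simp only <;> split_ifs <;> omega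

lemma isRCAlt_rcWord_iff {n : ℕ} (w : Perm (Fin n)) (s : Finset (Fin n)) :
    IsRCAlt n (rcWord w s) ↔ s ⊆ wordValleys w := by
  simp [IsRCAlt, isPermOn_rcWord, rcInv_rcWord, downUpN_rcWord_iff]

lemma rcWord_injective {n : ℕ} :
    Function.Injective fun x : Perm (Fin n) × Finset (Fin n) => rcWord x.1 x.2 := by
  rintro ⟨w, s⟩ ⟨w', s'⟩ h
  have key : ∀ j, w j = w' j ∧ (j ∈ s ↔ j ∈ s') := by
    intro j
    have hj := signedValue_inj (w _).isLt (w' _).isLt (congrFun h (rightFin j))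
    rw [foldFin_rightFin] at hj
    exact ⟨Fin.ext hj.1, by tauto⟩
  exact Prod.ext (Equiv.ext fun j => (key j).1) (Finset.ext fun j => (key j).2)

lemma exists_rcWord_eq {n : ℕ} {a : Fin (2 * n) → ℕ} (ha : IsPermOn (2 * n) a)
    (hrc : RCInv (2 * n) a) : ∃ w s, rcWord w s = a := by
  obtain ⟨hinj, hmem⟩ := ha
  simp only [mem_Icc] at hmem
  have hleft : ∀ i : Fin (2 * n), (i : ℕ) < n →
      a i = 2 * n + 1 - a (rightFin (foldFin i)) ∧
        rightFin (foldFin i) = ⟨2 * n - 1 - i, by omega⟩ := by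
    intro i hi
    have : rightFin (foldFin i) = ⟨2 * n - 1 - i, by omega⟩ := by
      ext; simp only [rightFin, foldFin]; split_ifs <;> omega
    refine ⟨?_, this⟩
    rw [this, hrc i]
    have := hmem i
    omega
  let f : Fin n → Fin n := fun j =>
    ⟨if n < a (rightFin j) then a (rightFin j) - n - 1 else n - a (rightFin j), by
      have := hmem (rightFin j); split_ifs <;> omega⟩
  have hf : Function.Injective f := by
    intro j j' h
    have h1 := congrArg Fin.val h
    simp only [f] at h1
    have hm := hmem (rightFin j)
    have hm' := hmem (rightFin j')
    have h2 : a (rightFin j) = a (rightFin j') ∨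
        a (rightFin j) = 2 * n + 1 - a (rightFin j') := by
      split_ifs at h1 <;> omega
    rcases h2 with h2 | h2
    · simpa [foldFin_rightFin] using congrArg foldFin (hinj h2)
    · rw [← hrc (rightFin j')] at h2
      have := congrArg Fin.val (hinj h2)
      simp only [rightFin] at this
      omega
  refine ⟨Equiv.ofBijective f (Finite.injective_iff_bijective.1 hf),
    ({j | ¬ ((n + j : ℕ) % 2 = 0 ↔ n < a (rightFin j))} : Finset (Fin n)), ?_⟩
  ext i
  have hm := hmem i
  have hm' := hmem (rightFin (foldFin i))
  simp only [rcWord, signedValue, mem_filter, mem_univ, true_and, Equiv.ofBijective_apply, f]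
  by_cases hi : (i : ℕ) < n
  · obtain ⟨h1, h2⟩ := hleft i hi
    have h3 : n + (foldFin i : ℕ) = 2 * n - 1 - i := congrArg Fin.val h2
    rw [h3]
    split_ifs <;> omega
  · have h2 : rightFin (foldFin i) = i := by
      ext; simp only [rightFin, foldFin]; split_ifs <;> omega
    have h3 : n + (foldFin i : ℕ) = i := congrArg Fin.val h2
    rw [h3, h2]
    split_ifs <;> omega

lemma card_rcAlt (n : ℕ) :
    Nat.card {a : Fin (2 * n) → ℕ // IsRCAlt n a} =
      ∑ w : Perm (Fin n), 2 ^ #(wordValleys w) := by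
  have e : {x : Perm (Fin n) × Finset (Fin n) // x.2 ⊆ wordValleys x.1} ≃
      {a : Fin (2 * n) → ℕ // IsRCAlt n a} := by
    refine Equiv.ofBijective
      (fun x => ⟨rcWord x.1.1 x.1.2, (isRCAlt_rcWord_iff _ _).2 x.2⟩) ⟨?_, ?_⟩
    · intro x y h
      exact Subtype.ext (rcWord_injective (congrArg Subtype.val h))
    · rintro ⟨a, ha⟩
      obtain ⟨w, s, rfl⟩ := exists_rcWord_eq ha.1 ha.2.2
      exact ⟨⟨(w, s), (isRCAlt_rcWord_iff w s).1 ha⟩, rfl⟩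
  rw [← Nat.card_congr e, Nat.card_congr (Equiv.subtypeProdEquivSigmaSubtype
    fun (w : Perm (Fin n)) (s : Finset (Fin n)) => s ⊆ wordValleys w), Nat.card_sigma]
  refine sum_congr rfl fun w _ => ?_
  rw [← card_powerset, Nat.card_eq_fintype_card, Fintype.card_subtype]
  congr 1
  ext s
  simp

theorem card_wip_eq_card_rcAlt (n : ℕ) :
    Nat.card {p : Perm (Fin n) × Perm (Fin n) // IsWIP3 n p} =
      Nat.card {a : Fin (2 * n) → ℕ // IsRCAlt n a} := by
  rw [card_wip, card_rcAlt, sum_card_cycPeaks n fun v => 2 ^ v,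
    sum_card_cycValleys_eq_sum_card_wordValleys n fun v => 2 ^ v]

/-- For every positive integer `n` there is a bijection between the set
`𝔚ₙ` of weakly increasing 3-dimensional permutations of length `n` and the set `ℜₙ` of
rc-invariant alternating permutations of `{1, …, 2n}`; in particular `|𝔚ₙ| = |ℜₙ|`. -/
theorem wip_equiv_rcAlt (n : ℕ) (hn : 0 < n) :
    Nonempty ({p : Equiv.Perm (Fin n) × Equiv.Perm (Fin n) // IsWIP3 n p} ≃
      {a : Fin (2 * n) → ℕ // IsRCAlt n a}) ∧
    Nat.card {p : Equiv.Perm (Fin n) × Equiv.Perm (Fin n) // IsWIP3 n p} =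
      Nat.card {a : Fin (2 * n) → ℕ // IsRCAlt n a} := by
  have h := card_wip_eq_card_rcAlt n
  have : Nonempty {p : Perm (Fin n) × Perm (Fin n) // IsWIP3 n p} :=
    ⟨⟨(1, 1), fun i j hij => by simpa using hij⟩⟩
  have : Finite {a : Fin (2 * n) → ℕ // IsRCAlt n a} :=
    Nat.finite_of_card_ne_zero (h ▸ Nat.card_pos.ne')
  exact ⟨Finite.card_eq.1 h, h⟩
end

section
/- For every positive integer n, there exists a bijection between the set 𝔚_n of weakly increasing 3-dimensional permutations of length n and the set 𝒫_n of labeled ballot paths of length n; in particular |𝔚_n| = |𝒫_n|. -/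
open Equiv

/-- A permutation with a set of selected elements, each exceeding its image and its preimage. -/
def PeakSelection (α : Type*) [LinearOrder α] : Type _ :=
  {p : Perm α × (α → Bool) // ∀ a, p.2 a = true → p.1 a < a ∧ p.1.symm a < a}

namespace PeakSelection

variable {α β : Type*} [LinearOrder α] [LinearOrder β]

/-- The number of selected elements. -/
def num [Fintype α] (x : PeakSelection α) : ℕ := ∑ a, (x.1.2 a).toNat

/-- The elements such that neither they nor their preimages are selected. -/
abbrev Free (x : PeakSelection α) : Type _ :=
  {i : α // x.1.2 i = false ∧ x.1.2 (x.1.1.symm i) = false}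

theorem card_free_add [Fintype α] (x : PeakSelection α) :
    Fintype.card x.Free + 2 * x.num = Fintype.card α := by
  have h : ∑ a, (x.1.2 (x.1.1.symm a)).toNat = x.num :=
    Equiv.sum_comp x.1.1.symm (fun a => (x.1.2 a).toNat)
  have key : ∀ a, (if x.1.2 a = false ∧ x.1.2 (x.1.1.symm a) = false then 1 else 0)
      + ((x.1.2 a).toNat + (x.1.2 (x.1.1.symm a)).toNat) = 1 := by
    intro a
    have h1 := x.2 a
    have h2 := x.2 (x.1.1.symm a)
    cases e1 : x.1.2 a <;> cases e2 : x.1.2 (x.1.1.symm a) <;> simp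
    have h1 := (h1 e1).2
    have h2 := (h2 e2).1
    rw [Equiv.apply_symm_apply] at h2
    exact absurd h1 h2.asymm
  have hs := Finset.sum_congr (rfl : (Finset.univ : Finset α) = _) (fun a _ => key a)
  rw [Finset.sum_add_distrib, Finset.sum_add_distrib, h, ← Finset.card_filter,
    ← Fintype.card_subtype] at hs
  simp only [Finset.sum_const, Finset.card_univ, smul_eq_mul, mul_one] at hs
  rw [← hs, two_mul]
  rfl

/-- Peak selections transported along an order isomorphism. -/
def congr (f : α ≃o β) : PeakSelection α ≃ PeakSelection β :=
  (Equiv.prodCongr f.toEquiv.permCongr (f.toEquiv.arrowCongr (Equiv.refl Bool))).subtypeEquiv <| by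
    rintro ⟨σ, T⟩
    refine f.toEquiv.forall_congr fun a => ?_
    have h : (f.toEquiv.permCongr σ).symm (f a) = f (σ.symm a) := by
      simp [Equiv.symm_apply_eq]
    simp [h]

theorem num_congr [Fintype α] [Fintype β] (f : α ≃o β) (x : PeakSelection α) :
    (congr f x).num = x.num :=
  Equiv.sum_comp f.symm.toEquiv (fun a => (x.1.2 a).toNat)

/-- The data obtained from a peak selection by cutting the top element out of its cycle:
the image of that element (`none` for a fixed point) with the remaining permutation, and whether
the element was selected with the remaining selection. -/
def IsCut (q : (Option α × Perm α) × (Bool × (α → Bool))) : Prop :=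
  (∀ a, q.2.2 a = true → q.1.2 a < a ∧ q.1.2.symm a < a) ∧
  (∀ i, q.1.1 = some i → q.2.2 i = false ∧ q.2.2 (q.1.2.symm i) = false) ∧
  (q.2.1 = true → q.1.1 ≠ none)

theorem forall_peak_iff (i : Option α) (σ : Perm α) (T : WithTop α → Bool)
    (τ : Perm (WithTop α)) (hτ : τ = (Perm.decomposeOption.symm (i, σ) : Perm (Option α))) :
    (∀ a, T a = true → τ a < a ∧ τ.symm a < a) ↔ IsCut ((i, σ), (T ⊤, fun a : α => T a)) := by
  have top_apply : τ ⊤ = i := by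
    subst hτ
    change (Perm.decomposeOption.symm (i, σ) : Perm (Option α)) none = i
    simp
  have coe_apply (a : α) : τ a = if i = some (σ a) then (⊤ : WithTop α) else (σ a : α) := by
    subst hτ
    change (Perm.decomposeOption.symm (i, σ) : Perm (Option α)) (some a) =
      if i = some (σ a) then none else some (σ a)
    rcases i with _ | i <;> simp [swap_apply_def, eq_comm]
  have symm_coe (a : α) : τ.symm a = if i = some a then (⊤ : WithTop α) else (σ.symm a : α) := by
    rw [Equiv.symm_apply_eq]
    split_ifs with h
    · rw [top_apply, h]; rfl
    · simp [coe_apply, h]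
  have symm_top_none (h : i = none) : τ.symm ⊤ = ⊤ := by
    rw [Equiv.symm_apply_eq, top_apply, h]; rfl
  have symm_top_some (j : α) (h : i = some j) : τ.symm ⊤ = (σ.symm j : α) := by
    rw [Equiv.symm_apply_eq, coe_apply]; simp [h]
  simp only [IsCut]
  constructor
  · intro h
    refine ⟨fun a ha => ?_, fun j hj => ⟨?_, ?_⟩, fun ht hi => ?_⟩
    · have := h a ha
      rw [coe_apply, symm_coe] at this
      split_ifs at this
      · exact (not_top_lt this.1).elim
      · exact (not_top_lt this.1).elim
      · exact (not_top_lt this.2).elim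
      · exact ⟨WithTop.coe_lt_coe.1 this.1, WithTop.coe_lt_coe.1 this.2⟩
    · by_contra hc
      have := (h j (by simpa using hc)).2
      simp [symm_coe, hj] at this
    · by_contra hc
      have := (h (σ.symm j : α) (by simpa using hc)).1
      simp [coe_apply, hj] at this
    · have := (h ⊤ ht).2
      simp [symm_top_none hi] at this
  · rintro ⟨h1, h2, h3⟩ a ha
    induction a with
    | top =>
      obtain ⟨j, rfl⟩ := Option.ne_none_iff_exists'.1 (h3 ha)
      rw [top_apply, symm_top_some j rfl]
      exact ⟨WithTop.coe_lt_top j, WithTop.coe_lt_top _⟩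
    | coe a =>
      have ha1 : i ≠ some (σ a) := fun hi => by
        have := (h2 _ hi).2
        simp [ha] at this
      have ha2 : i ≠ some a := fun hi => by
        have := (h2 _ hi).1
        simp [ha] at this
      simpa [coe_apply, symm_coe, ha1, ha2] using h1 a ha

/-- Cutting the top element out of its cycle. -/
def cutEquiv : PeakSelection (WithTop α) ≃ {q // IsCut (α := α) q} :=
  (Equiv.prodCongr (α₁ := Perm (WithTop α)) (α₂ := Option α × Perm α)
    (β₁ := WithTop α → Bool)
    Perm.decomposeOption (Equiv.piOptionEquivProd (β := fun _ : Option α => Bool))).subtypeEquiv <| by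
    rintro ⟨τ, T⟩
    obtain ⟨⟨i, σ⟩, rfl⟩ := (Perm.decomposeOption (α := α)).symm.surjective τ
    have h : Prod.map Perm.decomposeOption (Equiv.piOptionEquivProd (β := fun _ => Bool))
        (Perm.decomposeOption.symm (i, σ), T) = ((i, σ), (T ⊤, fun a : α => T a)) :=
      Prod.ext (Equiv.apply_symm_apply _ _) rfl
    exact (forall_peak_iff i σ T _ rfl).trans (iff_of_eq (congrArg IsCut h.symm))

/-- Cut data amount to a smaller peak selection with an insertion place. -/
def cutEquivSigma : {q // IsCut (α := α) q} ≃ Σ x : PeakSelection α, Option x.Free ⊕ x.Free where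
  toFun
    | ⟨((none, σ), (false, T)), h⟩ => ⟨⟨(σ, T), h.1⟩, .inl none⟩
    | ⟨((some i, σ), (false, T)), h⟩ => ⟨⟨(σ, T), h.1⟩, .inl (some ⟨i, h.2.1 i rfl⟩)⟩
    | ⟨((some i, σ), (true, T)), h⟩ => ⟨⟨(σ, T), h.1⟩, .inr ⟨i, h.2.1 i rfl⟩⟩
    | ⟨((none, σ), (true, T)), h⟩ => (h.2.2 rfl rfl).elim
  invFun
    | ⟨x, .inl none⟩ => ⟨((none, x.1.1), (false, x.1.2)), x.2, by simp, by simp⟩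
    | ⟨x, .inl (some i)⟩ => ⟨((some i.1, x.1.1), (false, x.1.2)), x.2, by simpa using i.2, by simp⟩
    | ⟨x, .inr i⟩ => ⟨((some i.1, x.1.1), (true, x.1.2)), x.2, by simpa using i.2, by simp⟩
  left_inv := by
    rintro ⟨⟨⟨_ | i, σ⟩, ⟨_ | _, T⟩⟩, h⟩
    · rfl
    · exact (h.2.2 rfl rfl).elim
    · rfl
    · rfl
  right_inv := by
    rintro ⟨x, (_ | i) | i⟩ <;> rfl

/-- A peak selection on `WithTop α` is one on `α` with an insertion place for the top element. -/
def withTopEquiv : PeakSelection (WithTop α) ≃ Σ x : PeakSelection α, Option x.Free ⊕ x.Free :=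
  cutEquiv.trans cutEquivSigma

theorem num_withTopEquiv_symm_inl [Fintype α] (x : PeakSelection α) (i : Option x.Free) :
    (withTopEquiv.symm ⟨x, .inl i⟩).num = x.num := by
  refine (Fintype.sum_option _).trans ?_
  rcases i with _ | i <;> exact Nat.zero_add _

theorem num_withTopEquiv_symm_inr [Fintype α] (x : PeakSelection α) (i : x.Free) :
    (withTopEquiv.symm ⟨x, .inr i⟩).num = x.num + 1 :=
  (Fintype.sum_option _).trans (Nat.add_comm _ _)

end PeakSelection

namespace PeakSelection

/-- A key for sorting the rows `a` of a permutation matrix by `max a (τ a)`, in which the selection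
`T` decides the order of the two rows sharing a maximum. -/
def key {n : ℕ} (τ : Perm (Fin n)) (T : Fin n → Bool) (a : Fin n) : ℕ :=
  2 * (max a (τ a) : Fin n) + (xor (decide (τ a ≤ a)) (T (max a (τ a)))).toNat

variable {n : ℕ} {τ : Perm (Fin n)} {T : Fin n → Bool}

theorem key_lt_key {a b : Fin n} (h : max a (τ a) < max b (τ b)) : key τ T a < key τ T b := by
  have := Bool.toNat_le (xor (decide (τ a ≤ a)) (T (max a (τ a))))
  have h' : ((max a (τ a) : Fin n) : ℕ) < (max b (τ b) : Fin n) := h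
  unfold key
  omega

theorem max_le_of_key_le {a b : Fin n} (h : key τ T a ≤ key τ T b) :
    max a (τ a) ≤ max b (τ b) :=
  not_lt.1 fun hc => (key_lt_key hc).not_ge h

theorem key_injective : Function.Injective (key τ T) := by
  intro a b h
  have hm := (max_le_of_key_le h.le).antisymm (max_le_of_key_le h.ge)
  have hb : decide (τ a ≤ a) = decide (τ b ≤ b) := by
    simp only [key, hm, add_right_inj] at h
    revert h
    generalize decide (τ a ≤ a) = p, decide (τ b ≤ b) = q, T (max b (τ b)) = r
    revert p q r
    decide
  rw [decide_eq_decide] at hb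
  by_cases ha : τ a ≤ a
  · rwa [max_eq_left ha, max_eq_left (hb.1 ha)] at hm
  · rw [max_eq_right (not_le.1 ha).le, max_eq_right (not_le.1 (mt hb.2 ha)).le] at hm
    exact τ.injective hm

theorem key_of_le {a : Fin n} (h : τ a ≤ a) : key τ T a = 2 * a + (!T a).toNat := by
  simp [key, h]

theorem key_of_lt {a : Fin n} (h : a < τ a) : key τ T a = 2 * τ a + (T (τ a)).toNat := by
  simp [key, h.le, h.not_ge]

theorem strictMono_key_sort : StrictMono (key τ T ∘ Tuple.sort (key τ T)) :=
  (Tuple.monotone_sort _).strictMono_of_injective (key_injective.comp (Equiv.injective _))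

theorem eq_sort_key {σ : Perm (Fin n)} (h : Monotone (key τ T ∘ σ)) :
    σ = Tuple.sort (key τ T) := by
  have := Tuple.unique_monotone h (Tuple.monotone_sort _)
  exact Equiv.ext fun i => key_injective (congrFun this i)

/-- A selected element comes before its preimage in the sorted order. -/
theorem apply_eq_true_iff (x : PeakSelection (Fin n)) {σ : Perm (Fin n)}
    (h : StrictMono (key x.1.1 x.1.2 ∘ σ)) (m : Fin n) :
    x.1.2 m = true ↔
      x.1.1 m < m ∧ x.1.1.symm m < m ∧ σ.symm m < σ.symm (x.1.1.symm m) := by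
  have hlt (h1 : x.1.1 m < m) (h2 : x.1.1.symm m < m) :
      σ.symm m < σ.symm (x.1.1.symm m) ↔ x.1.2 m = true := by
    rw [← h.lt_iff_lt]
    simp only [Function.comp_apply, Equiv.apply_symm_apply]
    rw [key_of_le h1.le, key_of_lt (by simpa using h2), Equiv.apply_symm_apply]
    cases x.1.2 m <;> simp
  constructor
  · intro hm
    obtain ⟨h1, h2⟩ := x.2 m hm
    exact ⟨h1, h2, (hlt h1 h2).2 hm⟩
  · rintro ⟨h1, h2, h3⟩
    exact (hlt h1 h2).1 h3

/-- The weakly increasing 3-dimensional permutation sorting the points of a permutation matrix. -/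
def toWIP (x : PeakSelection (Fin n)) :
    {p : Perm (Fin n) × Perm (Fin n) // IsWIP3 n p} :=
  ⟨(Tuple.sort (key x.1.1 x.1.2), (Tuple.sort (key x.1.1 x.1.2)).trans x.1.1),
    fun _ _ hij => max_le_of_key_le (Tuple.monotone_sort (key x.1.1 x.1.2) hij)⟩

theorem toWIP_injective : Function.Injective (toWIP (n := n)) := by
  intro x y h
  have hσ := congrArg (fun p => p.1.1) h
  have hπ := congrArg (fun p => p.1.2) h
  simp only [toWIP] at hσ hπ
  have hx := strictMono_key_sort (τ := x.1.1) (T := x.1.2)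
  have hy := strictMono_key_sort (τ := y.1.1) (T := y.1.2)
  rw [← hσ] at hπ hy
  have hτ : x.1.1 = y.1.1 := by
    ext1 a
    simpa using congrArg (fun e : Perm (Fin n) => e ((Tuple.sort (key x.1.1 x.1.2)).symm a)) hπ
  refine Subtype.ext (Prod.ext hτ (funext fun m => Bool.eq_iff_iff.2 ?_))
  rw [apply_eq_true_iff x hx, apply_eq_true_iff y hy, hτ]

theorem toWIP_surjective : Function.Surjective (toWIP (n := n)) := by
  rintro ⟨⟨σ, π⟩, hp⟩
  obtain ⟨τ, rfl⟩ : ∃ τ : Perm (Fin n), π = σ.trans τ :=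
    ⟨σ.symm.trans π, Equiv.ext fun i => by simp⟩
  let x : PeakSelection (Fin n) :=
    ⟨(τ, fun m => decide (τ m < m ∧ τ.symm m < m ∧ σ.symm m < σ.symm (τ.symm m))),
      fun a ha => ⟨(of_decide_eq_true ha).1, (of_decide_eq_true ha).2.1⟩⟩
  have hmono : StrictMono (key x.1.1 x.1.2 ∘ σ) := by
    intro i j hij
    have hle : max (σ i) (τ (σ i)) ≤ max (σ j) (τ (σ j)) := hp i j hij.le
    rcases hle.lt_or_eq with hlt | heq
    · exact key_lt_key hlt
    have hne : σ i ≠ σ j := fun h => hij.ne (σ.injective h)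
    have hne' : τ (σ i) ≠ τ (σ j) := fun h => hne (τ.injective h)
    simp only [Function.comp_apply, x]
    rcases le_or_gt (τ (σ i)) (σ i) with hi | hi <;> rcases le_or_gt (τ (σ j)) (σ j) with hj | hj
    · rw [max_eq_left hi, max_eq_left hj] at heq
      exact absurd heq hne
    · rw [max_eq_left hi, max_eq_right hj.le] at heq
      have h1 : τ (σ i) < σ i := hi.lt_of_ne (heq ▸ hne')
      rw [key_of_le hi, key_of_lt hj, ← heq]
      have h2 : τ.symm (σ i) = σ j := by rw [heq, Equiv.symm_apply_apply]
      simp [h1, h2, hij, heq ▸ hj]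
    · rw [max_eq_right hi.le, max_eq_left hj] at heq
      rw [key_of_lt hi, key_of_le hj, heq]
      have h2 : τ.symm (σ j) = σ i := by rw [← heq, Equiv.symm_apply_apply]
      have h3 : σ i < σ j := heq ▸ hi
      simp [h2, h3, hj.lt_of_ne (heq ▸ hne'.symm), hij.not_gt]
    · rw [max_eq_right hi.le, max_eq_right hj.le] at heq
      exact absurd heq hne'
  refine ⟨x, Subtype.ext ?_⟩
  have hσ := eq_sort_key hmono.monotone
  exact Prod.ext hσ.symm (congrArg (fun s : Perm (Fin n) => s.trans τ) hσ.symm)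

/-- Peak selections on `Fin n` correspond to weakly increasing 3-dimensional permutations. -/
noncomputable def wipEquiv :
    PeakSelection (Fin n) ≃ {p : Perm (Fin n) × Perm (Fin n) // IsWIP3 n p} :=
  Equiv.ofBijective toWIP ⟨toWIP_injective, toWIP_surjective⟩

end PeakSelection

section LabeledBallotPath

theorem upCount_snoc_of_le {n : ℕ} (P : Fin n → Bool) (b : Bool) {i : ℕ} (hi : i ≤ n) :
    upCount (n + 1) (Fin.snoc P b : Fin (n + 1) → Bool) i = upCount n P i := by
  simp only [upCount, Finset.card_filter]
  rw [Fin.sum_univ_castSucc]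
  simp [hi.not_gt]

theorem downCount_snoc_of_le {n : ℕ} (P : Fin n → Bool) (b : Bool) {i : ℕ} (hi : i ≤ n) :
    downCount (n + 1) (Fin.snoc P b : Fin (n + 1) → Bool) i = downCount n P i := by
  simp only [downCount, Finset.card_filter]
  rw [Fin.sum_univ_castSucc]
  simp [hi.not_gt]

theorem upCount_snoc_self {n : ℕ} (P : Fin n → Bool) (b : Bool) :
    upCount (n + 1) (Fin.snoc P b : Fin (n + 1) → Bool) (n + 1) = upCount n P n + b.toNat := by
  simp only [upCount, Finset.card_filter]
  rw [Fin.sum_univ_castSucc]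
  cases b <;> simp

theorem downCount_snoc_self {n : ℕ} (P : Fin n → Bool) (b : Bool) :
    downCount (n + 1) (Fin.snoc P b : Fin (n + 1) → Bool) (n + 1) =
      downCount n P n + (!b).toNat := by
  simp only [downCount, Finset.card_filter]
  rw [Fin.sum_univ_castSucc]
  cases b <;> simp

theorem upCount_add_downCount {n : ℕ} (P : Fin n → Bool) :
    upCount n P n + downCount n P n = n := by
  simp only [upCount, downCount, Finset.card_filter, ← Finset.sum_add_distrib]
  rw [Finset.sum_congr rfl (g := fun _ => 1)]
  · simp
  · intro j _
    cases P j <;> simp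

theorem isLBP_snoc_iff {n : ℕ} (P : Fin n → Bool) (w : Fin n → ℕ) (b : Bool) (k : ℕ) :
    IsLBP (n + 1) (Fin.snoc P b, Fin.snoc w k) ↔ IsLBP n (P, w) ∧
      if b then k + downCount n P n ≤ upCount n P n
      else k + 1 + downCount n P n ≤ upCount n P n := by
  have hlabel (i : Fin n) := downCount_snoc_of_le P b i.2.le
  have hlabel' (i : Fin n) := upCount_snoc_of_le P b i.2.le
  simp only [IsLBP, Fin.forall_fin_succ', Fin.snoc_castSucc, Fin.snoc_last, Fin.val_castSucc,
    Fin.val_last, hlabel, hlabel', downCount_snoc_of_le P b le_rfl, upCount_snoc_of_le P b le_rfl]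
  rw [← and_assoc]
  refine and_congr_left fun hlast => and_congr_left fun _ => ?_
  constructor
  · intro h i hi
    simpa [downCount_snoc_of_le P b hi, upCount_snoc_of_le P b hi] using h i (by omega)
  · intro h i hi
    rcases Nat.lt_or_ge n i with hlt | hle
    · obtain rfl : i = n + 1 := by omega
      rw [downCount_snoc_self, upCount_snoc_self]
      cases b <;> simp at hlast ⊢ <;> omega
    · simpa [downCount_snoc_of_le P b hle, upCount_snoc_of_le P b hle] using h i hle

/-- Labeled ballot paths as a type. -/
abbrev LabeledBallotPath (n : ℕ) : Type := {pw : (Fin n → Bool) × (Fin n → ℕ) // IsLBP n pw}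

/-- The number of down steps of a labeled ballot path. -/
def LabeledBallotPath.down {n : ℕ} (y : LabeledBallotPath n) : ℕ := downCount n y.1.1 n

/-- Append a labeled last step to a labeled ballot path. -/
def LabeledBallotPath.append {n : ℕ} :
    (Σ y : LabeledBallotPath n, Fin (n - 2 * y.down + 1) ⊕ Fin (n - 2 * y.down)) →
      LabeledBallotPath (n + 1)
  | ⟨y, .inl k⟩ => ⟨(Fin.snoc y.1.1 true, Fin.snoc y.1.2 k), (isLBP_snoc_iff _ _ _ _).2 ⟨y.2, by
      have h1 := upCount_add_downCount y.1.1
      have h2 := y.2.1 n le_rfl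
      have h3 := k.2
      simp only [down] at h3
      simp only [if_true]
      omega⟩⟩
  | ⟨y, .inr k⟩ => ⟨(Fin.snoc y.1.1 false, Fin.snoc y.1.2 k), (isLBP_snoc_iff _ _ _ _).2 ⟨y.2, by
      have h1 := upCount_add_downCount y.1.1
      have h2 := k.2
      simp only [down] at h2
      simp only [Bool.false_eq_true, if_false]
      omega⟩⟩

theorem LabeledBallotPath.append_injective {n : ℕ} : Function.Injective (append (n := n)) := by
  rintro ⟨⟨⟨P, w⟩, hy⟩, k | k⟩ ⟨⟨⟨P', w'⟩, hy'⟩, k' | k'⟩ h <;>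
    simp only [append, Subtype.mk.injEq, Prod.mk.injEq, Fin.snoc_inj, Bool.true_eq_false,
      Bool.false_eq_true, and_true, and_false, false_and] at h
  all_goals
    obtain ⟨rfl, rfl, hk⟩ := h
    rw [Fin.ext hk]

theorem LabeledBallotPath.append_surjective {n : ℕ} : Function.Surjective (append (n := n)) := by
  rintro ⟨⟨P, w⟩, hy⟩
  induction P using Fin.snocCases with | _ P b
  induction w using Fin.snocCases with | _ w k
  obtain ⟨h, hk⟩ := (isLBP_snoc_iff P w b k).1 hy
  have hn := upCount_add_downCount P
  cases b
  · refine ⟨⟨⟨(P, w), h⟩, .inr ⟨k, ?_⟩⟩, rfl⟩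
    simp only [Bool.false_eq_true, if_false] at hk
    simp only [down]
    omega
  · refine ⟨⟨⟨(P, w), h⟩, .inl ⟨k, ?_⟩⟩, rfl⟩
    simp only [if_true] at hk
    simp only [down]
    omega

theorem LabeledBallotPath.down_append_inl {n : ℕ} (y : LabeledBallotPath n)
    (k : Fin (n - 2 * y.down + 1)) : (append ⟨y, .inl k⟩).down = y.down :=
  downCount_snoc_self _ _

theorem LabeledBallotPath.down_append_inr {n : ℕ} (y : LabeledBallotPath n)
    (k : Fin (n - 2 * y.down)) : (append ⟨y, .inr k⟩).down = y.down + 1 :=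
  downCount_snoc_self _ _

end LabeledBallotPath

theorem PeakSelection.exists_equiv_labeledBallotPath (n : ℕ) :
    ∃ e : PeakSelection (Fin n) ≃ LabeledBallotPath n, ∀ x, (e x).down = x.num := by
  induction n with
  | zero =>
    have : Unique (LabeledBallotPath 0) :=
      ⟨⟨⟨(finZeroElim, finZeroElim), by simp [IsLBP, IsBallot, downCount]⟩⟩,
        fun y => Subtype.ext (Subsingleton.elim _ _)⟩
    have : Unique (PeakSelection (Fin 0)) := ⟨⟨⟨(1, finZeroElim), fun a => a.elim0⟩⟩,
      fun y => Subtype.ext (Subsingleton.elim _ _)⟩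
    exact ⟨Equiv.ofUnique _ _, fun x => by simp [LabeledBallotPath.down, num, downCount]⟩
  | succ n ih =>
    obtain ⟨e, he⟩ := ih
    have hcard : Fintype.card (WithTop (Fin n)) = n + 1 := by
      rw [show Fintype.card (WithTop (Fin n)) = _ from Fintype.card_option, Fintype.card_fin]
    have hfree (x : PeakSelection (Fin n)) : Fintype.card x.Free = n - 2 * (e x).down := by
      have := x.card_free_add
      rw [Fintype.card_fin] at this
      rw [he]
      omega
    let f : (Σ x : PeakSelection (Fin n), Option x.Free ⊕ x.Free) ≃
        Σ y : LabeledBallotPath n, Fin (n - 2 * y.down + 1) ⊕ Fin (n - 2 * y.down) :=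
      Equiv.sigmaCongr e fun x => Equiv.sumCongr
        (Fintype.equivFinOfCardEq (by rw [Fintype.card_option, hfree]))
        (Fintype.equivFinOfCardEq (hfree x))
    let g : PeakSelection (WithTop (Fin n)) ≃ LabeledBallotPath (n + 1) :=
      withTopEquiv.trans (f.trans (Equiv.ofBijective _
        ⟨LabeledBallotPath.append_injective, LabeledBallotPath.append_surjective⟩))
    have hg (y) : (g y).down = y.num := by
      obtain ⟨⟨z, i | i⟩, rfl⟩ := withTopEquiv.symm.surjective y
      · rw [num_withTopEquiv_symm_inl, ← he]
        simp only [g, Equiv.trans_apply, Equiv.apply_symm_apply]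
        exact LabeledBallotPath.down_append_inl (e z) _
      · rw [num_withTopEquiv_symm_inr, ← he]
        simp only [g, Equiv.trans_apply, Equiv.apply_symm_apply]
        exact LabeledBallotPath.down_append_inr (e z) _
    let o := Fintype.orderIsoFinOfCardEq _ hcard
    exact ⟨(congr o).trans g, fun x => (hg _).trans (num_congr o x)⟩

/-- For every positive integer `n` there is a bijection between the set
`𝔚ₙ` of weakly increasing 3-dimensional permutations of length `n` and the set `𝒫ₙ` of
labeled ballot paths of length `n`; in particular `|𝔚ₙ| = |𝒫ₙ|`. -/
theorem wip_equiv_lbp (n : ℕ) (hn : 0 < n) :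
    Nonempty ({p : Equiv.Perm (Fin n) × Equiv.Perm (Fin n) // IsWIP3 n p} ≃
      {pw : (Fin n → Bool) × (Fin n → ℕ) // IsLBP n pw}) ∧
    Nat.card {p : Equiv.Perm (Fin n) × Equiv.Perm (Fin n) // IsWIP3 n p} =
      Nat.card {pw : (Fin n → Bool) × (Fin n → ℕ) // IsLBP n pw} := by
  obtain ⟨e, -⟩ := PeakSelection.exists_equiv_labeledBallotPath n
  have e' := PeakSelection.wipEquiv.symm.trans e
  exact ⟨⟨e'⟩, Nat.card_congr e'⟩
end

section
/- For every positive integer n, the number of weakly increasing 3-dimensional permutations of length n equals the sum over all permutations τ of {1,…,n} of 2 raised to the number of cycle peaks of τ; that is, |𝔚_n| = Σ_{τ ∈ 𝔖_n} 2^{cpk(τ)}. -/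
/-- The number of cycle peaks of `τ`: letters `k` with `τ⁻¹(k) < k` and `τ(k) < k`
(here `0`-indexed; the condition `τ⁻¹ k < k` automatically excludes the smallest letter). -/
def cpk (n : ℕ) (τ : Equiv.Perm (Fin n)) : ℕ :=
  (Finset.univ.filter (fun k : Fin n => τ⁻¹ k < k ∧ τ k < k)).card

open Nat in
theorem card_perm_comp_monotone {n : ℕ} {α : Type*} [LinearOrder α] [Fintype α]
    (f : Fin n → α) :
    Nat.card {ρ : Equiv.Perm (Fin n) // Monotone (f ∘ ρ)} =
      ∏ a, (Fintype.card {i // f i = a})! := by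
  rw [← DomMulAct.stabilizer_card f, ← Nat.card_eq_fintype_card]
  refine Nat.card_congr
    ((Equiv.mulRight (Tuple.sort f)⁻¹).subtypeEquiv fun ρ => ?_)
  rw [← Tuple.comp_sort_eq_comp_iff_monotone]
  exact eq_comm.trans
    ((Equiv.eq_comp_symm (Tuple.sort f) f (f ∘ ρ)).symm.trans eq_comm)

open Nat in
theorem factorial_card_max_fiber {n : ℕ} (τ : Equiv.Perm (Fin n)) (k : Fin n) :
    (Fintype.card {i // max i (τ i) = k})! = if τ⁻¹ k < k ∧ τ k < k then 2 else 1 := by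
  have eq_inv {i : Fin n} (h : τ i = k) : i = τ⁻¹ k := by simp [← h]
  have ha : τ (τ⁻¹ k) = k := by simp
  rw [Fintype.card_subtype]
  split_ifs with h
  · have hs : (Finset.univ.filter fun i => max i (τ i) = k) = {k, τ⁻¹ k} := by
      ext i
      simp only [Finset.mem_filter, Finset.mem_univ, true_and, Finset.mem_insert,
        Finset.mem_singleton]
      constructor
      · intro hi
        rcases max_choice i (τ i) with hm | hm
        · exact Or.inl (hm.symm.trans hi)
        · exact Or.inr (eq_inv (hm.symm.trans hi))
      · rintro (rfl | rfl)
        · exact max_eq_left h.2.le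
        · rw [ha]; exact max_eq_right h.1.le
    rw [hs, Finset.card_pair h.1.ne', Nat.factorial_two]
  · rw [Nat.factorial_eq_one, Finset.card_le_one]
    have key {i j : Fin n} (hi : max i (τ i) = k) (hj : max j (τ j) = k)
        (hik : i = k) (hjk : τ j = k) : i = j := by
      have hj' := eq_inv hjk
      subst hik
      have h1 : τ i ≤ i := le_of_le_of_eq (le_max_right _ _) hi
      have h2 : j ≤ i := le_of_le_of_eq (le_max_left _ _) hj
      by_contra hne
      refine h ⟨hj' ▸ lt_of_le_of_ne h2 (Ne.symm hne), lt_of_le_of_ne h1 fun he => hne ?_⟩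
      exact τ.injective (he.trans hjk.symm)
    intro i hi j hj
    simp only [Finset.mem_filter, Finset.mem_univ, true_and] at hi hj
    rcases max_choice i (τ i) with hi' | hi' <;> rcases max_choice j (τ j) with hj' | hj' <;>
      rw [hi] at hi' <;> rw [hj] at hj'
    · exact hi'.symm.trans hj'
    · exact key hi hj hi'.symm hj'.symm
    · exact (key hj hi hj'.symm hi'.symm).symm
    · exact τ.injective (hi'.symm.trans hj')

/-- A WIP `(σ, π)` corresponds to `τ = π σ⁻¹` with a listing `σ` of the letters along which
`max i (τ i)` is weakly increasing. -/
def wipEquiv (n : ℕ) :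
    {p : Equiv.Perm (Fin n) × Equiv.Perm (Fin n) // IsWIP3 n p} ≃
      Σ τ : Equiv.Perm (Fin n),
        {ρ : Equiv.Perm (Fin n) // Monotone ((fun i => max i (τ i)) ∘ ρ)} where
  toFun p := ⟨p.1.2 * p.1.1⁻¹, p.1.1, fun i j hij => by simpa using p.2 i j hij⟩
  invFun q := ⟨(q.2.1, q.1 * q.2.1), fun _ _ hij => q.2.2 hij⟩
  left_inv p := by simp
  right_inv q := Sigma.subtype_ext (mul_inv_cancel_right q.1 q.2.1) rfl

/-- `|𝔚ₙ| = ∑_{τ ∈ 𝔖ₙ} 2^{cpk(τ)}`. -/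
theorem wip_card_eq_sum_cpk (n : ℕ) (hn : 0 < n) :
    Nat.card {p : Equiv.Perm (Fin n) × Equiv.Perm (Fin n) // IsWIP3 n p} =
    ∑ τ : Equiv.Perm (Fin n), 2 ^ cpk n τ := by
  rw [Nat.card_congr (wipEquiv n), Nat.card_sigma]
  refine Finset.sum_congr rfl fun τ _ => ?_
  rw [card_perm_comp_monotone, cpk, ← Finset.prod_const, Finset.prod_filter]
  exact Finset.prod_congr rfl fun k _ => factorial_card_max_fiber τ k
end

section
/- For every positive integer n, the number of snakes of length n equals the sum over all permutations τ of {1,…,n} of 2 raised to the number of left peaks of τ; that is, |𝒮_n| = Σ_{τ ∈ 𝔖_n} 2^{lpk(τ)}. -/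
/-- The extended one-line word of `τ ∈ 𝔖ₙ` with values in `{1, …, n}` (`1`-based
positions) and the conventions `τ₀ = 0` and `τ_{n+1} = n+1`. -/
def permVal (n : ℕ) (τ : Equiv.Perm (Fin n)) (k : ℕ) : ℕ :=
  if h : 1 ≤ k ∧ k ≤ n then (τ ⟨k - 1, by omega⟩ : ℕ) + 1
  else if k = 0 then 0 else n + 1

/-- The number of left peaks of `τ`: positions `i ∈ {1, …, n}` with
`τ_{i-1} < τ_i > τ_{i+1}`, using the conventions `τ₀ = 0` and `τ_{n+1} = n+1`. -/
def lpk (n : ℕ) (τ : Equiv.Perm (Fin n)) : ℕ :=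
  ((Finset.Icc 1 n).filter (fun i =>
    permVal n τ (i - 1) < permVal n τ i ∧ permVal n τ (i + 1) < permVal n τ i)).card

/-- In a finite word without flat steps, the interior peaks and valleys alternate: their numbers
differ according to the directions of the first and last steps. -/
lemma card_peaks_add_eq_card_valleys_add (v : ℕ → ℕ) (m : ℕ) (hv : ∀ k ≤ m, v k ≠ v (k + 1)) :
    ((Finset.range m).filter fun i => v i < v (i + 1) ∧ v (i + 2) < v (i + 1)).card +
        (if v m < v (m + 1) then 1 else 0) =
      ((Finset.range m).filter fun i => v (i + 1) < v i ∧ v (i + 1) < v (i + 2)).card +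
        (if v 0 < v 1 then 1 else 0) := by
  induction m with
  | zero => simp
  | succ m ih =>
    have h := ih fun k hk => hv k (by omega)
    have h1 := hv m (by omega)
    have h2 := hv (m + 1) le_rfl
    simp only [Finset.card_filter, Finset.sum_range_succ] at h ⊢
    have e : m + 1 + 1 = m + 2 := rfl
    rw [e] at h2 ⊢
    split_ifs at h ⊢ <;> omega

lemma permVal_zero (n : ℕ) (τ : Equiv.Perm (Fin n)) : permVal n τ 0 = 0 := by
  simp [permVal]

lemma permVal_succ (n : ℕ) (τ : Equiv.Perm (Fin n)) (k : ℕ) (hk : k < n) :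
    permVal n τ (k + 1) = (τ ⟨k, hk⟩ : ℕ) + 1 := by
  simp [permVal, Nat.succ_le_of_lt hk]

lemma permVal_length_succ (n : ℕ) (τ : Equiv.Perm (Fin n)) : permVal n τ (n + 1) = n + 1 := by
  simp [permVal]

lemma permVal_ne_succ (n : ℕ) (τ : Equiv.Perm (Fin n)) (k : ℕ) (hk : k ≤ n) :
    permVal n τ k ≠ permVal n τ (k + 1) := by
  rcases hk.eq_or_lt with rfl | hk
  · rw [permVal_length_succ]
    cases k with
    | zero => simp [permVal_zero]
    | succ k =>
      rw [permVal_succ _ _ _ k.lt_succ_self]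
      omega
  · rw [permVal_succ _ _ _ hk]
    cases k with
    | zero => simp [permVal_zero]
    | succ k =>
      rw [permVal_succ _ _ _ (by omega)]
      intro h
      have heq : τ ⟨k, by omega⟩ = τ ⟨k + 1, hk⟩ := Fin.ext (by omega)
      simpa using τ.injective heq

/-- The (`0`-indexed) valleys of `τ`, with the conventions `τ₀ = 0` and `τ_{n+1} = n + 1`. -/
def valleys (n : ℕ) (τ : Equiv.Perm (Fin n)) : Finset (Fin n) :=
  Finset.univ.filter fun i =>
    permVal n τ (i + 1) < permVal n τ i ∧ permVal n τ (i + 1) < permVal n τ (i + 2)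

lemma lpk_eq_card_valleys (n : ℕ) (hn : 0 < n) (τ : Equiv.Perm (Fin n)) :
    lpk n τ = (valleys n τ).card := by
  have h := card_peaks_add_eq_card_valleys_add (permVal n τ) n (permVal_ne_succ n τ)
  have h0 : permVal n τ 0 < permVal n τ 1 := by
    rw [permVal_zero, permVal_succ n τ 0 hn]
    omega
  have h1 : permVal n τ n < permVal n τ (n + 1) := by
    obtain ⟨k, rfl⟩ : ∃ k, n = k + 1 := ⟨n - 1, by omega⟩
    rw [permVal_length_succ, permVal_succ _ _ _ k.lt_succ_self]
    omega
  rw [if_pos h0, if_pos h1, Nat.add_right_cancel_iff] at h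
  have hpeak : lpk n τ = ((Finset.range n).filter fun i =>
      permVal n τ i < permVal n τ (i + 1) ∧ permVal n τ (i + 2) < permVal n τ (i + 1)).card := by
    have hIcc : Finset.Icc 1 n = Finset.Ico (0 + 1) (n + 1) := by
      ext
      simp only [Finset.mem_Icc, Finset.mem_Ico]
      omega
    rw [lpk, Finset.card_filter, Finset.card_filter, Finset.range_eq_Ico, hIcc,
      ← Finset.sum_Ico_add']
    rfl
  rw [hpeak, h, valleys, Finset.card_filter, Finset.card_filter, Finset.sum_range]

/-- The word with absolute values `τ` whose signs are `+ - + - ⋯`, flipped at the positions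
in `S`. -/
def signedWord (n : ℕ) (τ : Equiv.Perm (Fin n)) (S : Finset (Fin n)) (i : Fin n) : ℤ :=
  if (i : ℕ) % 2 = 0 ↔ i ∉ S then ((τ i : ℕ) : ℤ) + 1 else -(((τ i : ℕ) : ℤ) + 1)

lemma natAbs_signedWord (n : ℕ) (τ : Equiv.Perm (Fin n)) (S : Finset (Fin n)) (i : Fin n) :
    (signedWord n τ S i).natAbs = τ i + 1 := by
  unfold signedWord
  split_ifs <;> omega

lemma signedWord_pos_iff (n : ℕ) (τ : Equiv.Perm (Fin n)) (S : Finset (Fin n)) (i : Fin n) :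
    0 < signedWord n τ S i ↔ ((i : ℕ) % 2 = 0 ↔ i ∉ S) := by
  unfold signedWord
  split_ifs with h <;> simp only [h, iff_true, iff_false] <;> omega

lemma isSignedPerm_signedWord (n : ℕ) (τ : Equiv.Perm (Fin n)) (S : Finset (Fin n)) :
    IsSignedPerm n (signedWord n τ S) := by
  refine ⟨fun i j h => ?_, fun i => ?_⟩
  · simp only [natAbs_signedWord] at h
    exact τ.injective (Fin.ext (by omega))
  · rw [natAbs_signedWord]
    have := (τ i).isLt
    omega

lemma isSnake_signedWord_iff (n : ℕ) (τ : Equiv.Perm (Fin n)) (S : Finset (Fin n)) :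
    IsSnake n (signedWord n τ S) ↔ S ⊆ valleys n τ := by
  have hstep (i : ℕ) (h : i + 1 < n) :
      (if i % 2 = 0 then signedWord n τ S ⟨i + 1, h⟩ < signedWord n τ S ⟨i, by omega⟩
        else signedWord n τ S ⟨i, by omega⟩ < signedWord n τ S ⟨i + 1, h⟩) ↔
      (⟨i, by omega⟩ ∈ S → permVal n τ (i + 1) < permVal n τ (i + 2)) ∧
      (⟨i + 1, h⟩ ∈ S → permVal n τ (i + 2) < permVal n τ (i + 1)) := by
    have hne := permVal_ne_succ n τ (i + 1) (by omega)
    have e : permVal n τ (i + 2) = (τ ⟨i + 1, h⟩ : ℕ) + 1 := permVal_succ n τ (i + 1) h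
    rw [e, permVal_succ n τ i (by omega)] at *
    by_cases h1 : (⟨i, by omega⟩ : Fin n) ∈ S <;> by_cases h2 : (⟨i + 1, h⟩ : Fin n) ∈ S <;>
      rcases Nat.mod_two_eq_zero_or_one i with hi | hi <;>
      simp [signedWord, h1, h2, hi, Nat.add_mod] <;> omega
  have hfirst : (∀ h : 0 < n, 0 < signedWord n τ S ⟨0, h⟩) ↔ ∀ h : 0 < n, ⟨0, h⟩ ∉ S := by
    simp [signedWord_pos_iff]
  simp only [IsSnake, isSignedPerm_signedWord, true_and, DownUpZ, hstep, hfirst]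
  constructor
  · rintro ⟨h0, h⟩ ⟨i, hi⟩ hS
    simp only [valleys, Finset.mem_filter, Finset.mem_univ, true_and]
    constructor
    · cases i with
      | zero => exact absurd hS (h0 hi)
      | succ i => exact (h i hi).2 hS
    · rcases Nat.lt_or_ge (i + 1) n with hlt | hge
      · exact (h i hlt).1 hS
      · obtain rfl : n = i + 1 := by omega
        rw [permVal_length_succ, permVal_succ _ _ _ hi]
        omega
  · intro h
    have hval (i : Fin n) (hi : i ∈ S) := (Finset.mem_filter.1 (h hi)).2
    refine ⟨fun hn hS => ?_, fun i hi => ⟨fun hS => (hval _ hS).2, fun hS => (hval _ hS).1⟩⟩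
    have := (hval _ hS).1
    simp [permVal_zero] at this

lemma signedWord_injective (n : ℕ) :
    Function.Injective fun p : (_ : Equiv.Perm (Fin n)) × Finset (Fin n) =>
      signedWord n p.1 p.2 := by
  rintro ⟨τ, S⟩ ⟨τ', S'⟩ h
  have hw (i) : signedWord n τ S i = signedWord n τ' S' i := congrFun h i
  obtain rfl : τ = τ' := by
    ext i
    have := congrArg Int.natAbs (hw i)
    simp only [natAbs_signedWord] at this
    omega
  obtain rfl : S = S' := by
    ext i
    have h1 := signedWord_pos_iff n τ S i
    rw [hw i, signedWord_pos_iff] at h1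
    tauto
  rfl

lemma exists_signedWord_eq (n : ℕ) (π : Fin n → ℤ) (hπ : IsSignedPerm n π) :
    ∃ τ S, signedWord n τ S = π := by
  obtain ⟨hinj, hb⟩ := hπ
  let f : Fin n → Fin n := fun i => ⟨(π i).natAbs - 1, by have := hb i; omega⟩
  have hf : Function.Injective f := fun i j hij => hinj <| by
    have h1 := hb i
    have h2 := hb j
    have h3 : (π i).natAbs - 1 = (π j).natAbs - 1 := congrArg Fin.val hij
    change (π i).natAbs = (π j).natAbs
    omega
  refine ⟨Equiv.ofBijective f (Finite.injective_iff_bijective.1 hf),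
    Finset.univ.filter fun i => ¬((i : ℕ) % 2 = 0 ↔ 0 < π i), ?_⟩
  ext i
  have h1 := hb i
  simp only [signedWord, Equiv.ofBijective_apply, Finset.mem_filter, Finset.mem_univ, true_and, f]
  split_ifs <;> omega

/-- `|𝒮ₙ| = ∑_{τ ∈ 𝔖ₙ} 2^{lpk(τ)}`. -/
theorem snake_card_eq_sum_lpk (n : ℕ) (hn : 0 < n) :
    Nat.card {π : Fin n → ℤ // IsSnake n π} =
    ∑ τ : Equiv.Perm (Fin n), 2 ^ lpk n τ := by
  classical
  have hsub (π : Fin n → ℤ) : π ∈ (Finset.univ.sigma fun τ => (valleys n τ).powerset).image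
      (fun p => signedWord n p.1 p.2) ↔ IsSnake n π := by
    simp only [Finset.mem_image, Finset.mem_sigma, Finset.mem_univ, true_and,
      Finset.mem_powerset, ← isSnake_signedWord_iff]
    constructor
    · rintro ⟨p, hp, rfl⟩
      exact hp
    · intro hπ
      obtain ⟨τ, S, rfl⟩ := exists_signedWord_eq n π hπ.1
      exact ⟨⟨τ, S⟩, hπ, rfl⟩
  rw [Nat.subtype_card _ hsub, Finset.card_image_of_injective _ (signedWord_injective n),
    Finset.card_sigma]
  simp only [Finset.card_powerset, lpk_eq_card_valleys n hn]
end
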